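/- arXiv:2604.23089 — 8 statements merged into one kernel-verified Lean document; each statement's English description precedes it below -/
import Mathlib

section
/- Let A_1,…,A_r ∈ M_n(ℂ) be Hermitian matrices and let η : M_n(ℂ) → M_n(ℂ) be the completely positive map η(X) = ∑_{i=1}^r A_i X A_i. Then the matrix pencil (A_1,…,A_r) is LR-semisimple if and only if η is symmetrically DS-scalable, i.e., there exists a positive definite matrix C ∈ M_n(ℂ) with η(C) = C⁻¹. -/
open Matrix
open scoped ComplexOrder

/-- A matrix pencil `(A 1, …, A r)` of size `n` is *splittable* if there exist subspaces
`R, L ⊆ ℂⁿ` of equal dimension `s` with `1 ≤ s ≤ n - 1` such that `Aᵢ(R) ⊆ L` for all `i`. -/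
def PencilSplittable {n r : ℕ} (A : Fin r → Matrix (Fin n) (Fin n) ℂ) : Prop :=
  ∃ (R L : Submodule ℂ (Fin n → ℂ)),
    1 ≤ Module.finrank ℂ R ∧ Module.finrank ℂ R ≤ n - 1 ∧
    Module.finrank ℂ R = Module.finrank ℂ L ∧
    ∀ i, Submodule.map ((A i).mulVecLin) R ≤ L

/-- A matrix pencil is *unsplittable* if it is nonzero and not splittable. -/
def PencilUnsplittable {n r : ℕ} (A : Fin r → Matrix (Fin n) (Fin n) ℂ) : Prop :=
  (∃ i, A i ≠ 0) ∧ ¬ PencilSplittable A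

/-- A matrix pencil is *LR-semisimple* if, after multiplying by invertible matrices `L` and `R`
on the left and right, it becomes simultaneously block diagonal (for a decomposition
`n = n₁ + ⋯ + n_k`, encoded by the equivalence `e`) with unsplittable diagonal blocks. -/
def PencilLRSemisimple {n r : ℕ} (A : Fin r → Matrix (Fin n) (Fin n) ℂ) : Prop :=
  ∃ (L R : Matrix (Fin n) (Fin n) ℂ), IsUnit L ∧ IsUnit R ∧
    ∃ (k : ℕ) (d : Fin k → ℕ)
      (B : (j : Fin k) → Fin r → Matrix (Fin (d j)) (Fin (d j)) ℂ)
      (e : Fin n ≃ (Σ j : Fin k, Fin (d j))),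
      (∀ i, L * A i * R = (Matrix.blockDiagonal' (fun j => B j i)).submatrix e e) ∧
      ∀ j, PencilUnsplittable (B j)

/-- A positive definite matrix has a positive definite square root which commutes with everything
that commutes with the matrix. -/
lemma exists_posDef_sqrt {α : Type*} [Fintype α] [DecidableEq α] {C : Matrix α α ℂ}
    (hC : C.PosDef) :
    ∃ g : Matrix α α ℂ, g.PosDef ∧ g * g = C ∧ ∀ M, Commute M C → Commute M g := by
  open scoped MatrixOrder Matrix.Norms.L2Operator in
  have h0 : 0 ≤ C := Matrix.nonneg_iff_posSemidef.2 hC.posSemidef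
  have hsq : CFC.sqrt C * CFC.sqrt C = C := CFC.sqrt_mul_sqrt_self C h0
  have hp : (CFC.sqrt C).PosSemidef := Matrix.nonneg_iff_posSemidef.1 (CFC.sqrt_nonneg C)
  refine ⟨CFC.sqrt C, ?_, hsq, fun M hM => ?_⟩
  · rw [hp.posDef_iff_det_ne_zero]
    intro h
    have := hC.det_pos
    rw [← hsq, Matrix.det_mul, h] at this
    simp at this
  · rw [CFC.sqrt_eq_cfc]
    exact (Commute.cfc_nnreal hM.symm _).symm

/-- If the Hermitian pencil
`A` satisfies `∑ Aᵢ² = D⁻¹` and `∑ Aᵢ D Aᵢ = 1`, then every `Aᵢ` commutes with `D`. -/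
lemma commute_of_scaling {α ι : Type*} [Fintype α] [DecidableEq α] [Fintype ι]
    {A : ι → Matrix α α ℂ} (hA : ∀ i, (A i).IsHermitian) {D : Matrix α α ℂ} (hD : D.PosDef)
    (h1 : ∑ i, A i * A i = D⁻¹) (h2 : ∑ i, A i * D * A i = 1) (i : ι) : Commute (A i) D := by
  have hDu : IsUnit D.det := (Matrix.isUnit_iff_isUnit_det _).1 hD.isUnit
  have key : ∀ i, ((A i * D - D * A i)ᴴ * (A i * D - D * A i)).trace
      = 2 * ((D * D * (A i * A i)).trace - (D * (A i * D * A i)).trace) := by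
    intro i
    simp only [conjTranspose_sub, conjTranspose_mul, (hA i).eq, hD.1.eq, Matrix.sub_mul,
      Matrix.mul_sub, Matrix.trace_sub]
    have e1 : (D * A i * (A i * D)).trace = (D * D * (A i * A i)).trace := by
      rw [← Matrix.mul_assoc, Matrix.trace_mul_comm]
      simp only [Matrix.mul_assoc]
    have e2 : (A i * D * (A i * D)).trace = (D * (A i * D * A i)).trace := by
      rw [← Matrix.mul_assoc, Matrix.trace_mul_comm]
    have e3 : (A i * D * (D * A i)).trace = (D * D * (A i * A i)).trace := by
      rw [← Matrix.mul_assoc, Matrix.trace_mul_comm, Matrix.mul_assoc (A i),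
        ← Matrix.mul_assoc (A i), Matrix.trace_mul_comm]
    rw [e1, e2, e3]
    have e4 : (D * A i * (D * A i)).trace = (D * (A i * D * A i)).trace := by
      simp only [Matrix.mul_assoc]
    rw [e4]
    ring
  have hsum : ∑ i, ((A i * D - D * A i)ᴴ * (A i * D - D * A i)).trace = 0 := by
    simp only [key]
    rw [← Finset.mul_sum, Finset.sum_sub_distrib, ← Matrix.trace_sum, ← Matrix.trace_sum,
      ← Matrix.mul_sum, ← Matrix.mul_sum, h1, h2, Matrix.mul_assoc, Matrix.mul_nonsing_inv _ hDu]
    simp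
  have hz := (Finset.sum_eq_zero_iff_of_nonneg (fun i _ =>
    (Matrix.posSemidef_conjTranspose_mul_self (A i * D - D * A i)).trace_nonneg)).1 hsum i
      (Finset.mem_univ i)
  rw [Matrix.trace_conjTranspose_mul_self_eq_zero_iff] at hz
  exact sub_eq_zero.1 hz

/-- The covariance map of a Hermitian pencil that is scalable by a pair `(X, Y)` is symmetrically
scalable, by the geometric mean of `X` and `Y`. -/
lemma exists_symmetric_scaling {α ι : Type*} [Fintype α] [DecidableEq α] [Fintype ι]
    {A : ι → Matrix α α ℂ} (hA : ∀ i, (A i).IsHermitian) {X Y : Matrix α α ℂ}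
    (hX : X.PosDef) (hY : Y.PosDef) (h1 : ∑ i, A i * X * A i = Y⁻¹)
    (h2 : ∑ i, A i * Y * A i = X⁻¹) :
    ∃ C : Matrix α α ℂ, C.PosDef ∧ ∑ i, A i * C * A i = C⁻¹ := by
  obtain ⟨g, hg, rfl, -⟩ := exists_posDef_sqrt hX
  have hgu : IsUnit g.det := (Matrix.isUnit_iff_isUnit_det _).1 hg.isUnit
  have hgi : g⁻¹ᴴ = g⁻¹ := by rw [Matrix.conjTranspose_nonsing_inv, hg.1.eq]
  have a1 : g⁻¹ * g = 1 := Matrix.nonsing_inv_mul _ hgu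
  have a2 : g * g⁻¹ = 1 := Matrix.mul_nonsing_inv _ hgu
  have hD : (g⁻¹ * Y * g⁻¹).PosDef := by
    have := (hg.inv.isUnit.posDef_star_left_conjugate_iff (x := Y)).2 hY
    rwa [Matrix.star_eq_conjTranspose, hgi] at this
  have hA' : ∀ i, (g * A i * g).IsHermitian := fun i => by
    simp only [Matrix.IsHermitian, Matrix.conjTranspose_mul, hg.1.eq, (hA i).eq, Matrix.mul_assoc]
  have conj : ∀ Z, ∑ i, (g * A i * g) * Z * (g * A i * g) =
      g * (∑ i, A i * (g * Z * g) * A i) * g :=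
    fun Z => by simp only [Matrix.mul_sum, Matrix.sum_mul, Matrix.mul_assoc]
  have k1 : ∑ i, (g * A i * g) * (g * A i * g) = (g⁻¹ * Y * g⁻¹)⁻¹ := by
    have := conj 1
    simp only [Matrix.mul_one] at this
    rw [this, h1, Matrix.mul_inv_rev, Matrix.mul_inv_rev, Matrix.nonsing_inv_nonsing_inv _ hgu,
      Matrix.mul_assoc]
  have k2 : ∑ i, (g * A i * g) * (g⁻¹ * Y * g⁻¹) * (g * A i * g) = 1 := by
    rw [conj]
    have : g * (g⁻¹ * Y * g⁻¹) * g = Y := by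
      rw [← Matrix.mul_assoc, ← Matrix.mul_assoc, a2, Matrix.one_mul, Matrix.mul_assoc, a1,
        Matrix.mul_one]
    rw [this, h2, Matrix.mul_inv_rev, ← Matrix.mul_assoc, a2, Matrix.one_mul, a1]
  have hcomm := commute_of_scaling hA' hD k1 k2
  obtain ⟨c, hc, hcc, hcm⟩ := exists_posDef_sqrt hD
  have hcu : IsUnit c.det := (Matrix.isUnit_iff_isUnit_det _).1 hc.isUnit
  refine ⟨g * c * g, ?_, ?_⟩
  · have := (hg.isUnit.posDef_star_left_conjugate_iff (x := c)).2 hc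
    rwa [Matrix.star_eq_conjTranspose, hg.1.eq] at this
  · have h3 : ∑ i, (g * A i * g) * c * (g * A i * g) = c⁻¹ := by
      have : ∀ i, (g * A i * g) * c * (g * A i * g) = c * ((g * A i * g) * (g * A i * g)) :=
        fun i => by rw [(hcm _ (hcomm i)).eq, Matrix.mul_assoc]
      rw [Finset.sum_congr rfl fun i _ => this i, ← Matrix.mul_sum, k1, ← hcc, Matrix.mul_inv_rev,
        ← Matrix.mul_assoc, Matrix.mul_nonsing_inv _ hcu, Matrix.one_mul]
    rw [conj] at h3
    rw [Matrix.mul_inv_rev, Matrix.mul_inv_rev, ← h3]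
    simp only [← Matrix.mul_assoc, a1, Matrix.one_mul]
    simp only [Matrix.mul_assoc, a2, Matrix.mul_one]

/-- A coordinate-free form of `PencilLRSemisimple`: the pencil is equivalent to a block diagonal
pencil with unsplittable blocks, the blocks being indexed by an arbitrary finite type. -/
def PencilDecomposable {α : Type} [Fintype α] [DecidableEq α] {r : ℕ}
    (A : Fin r → Matrix α α ℂ) : Prop :=
  ∃ (ι : Type) (_ : Fintype ι) (_ : DecidableEq ι) (d : ι → ℕ)
    (B : (j : ι) → Fin r → Matrix (Fin (d j)) (Fin (d j)) ℂ)
    (L : Matrix (Σ j, Fin (d j)) α ℂ) (L' : Matrix α (Σ j, Fin (d j)) ℂ)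
    (R : Matrix α (Σ j, Fin (d j)) ℂ) (R' : Matrix (Σ j, Fin (d j)) α ℂ),
    (L * L' = 1 ∧ L' * L = 1) ∧ (R * R' = 1 ∧ R' * R = 1) ∧
    (∀ i, L * A i * R = Matrix.blockDiagonal' (fun j => B j i)) ∧ ∀ j, PencilUnsplittable (B j)

lemma PencilDecomposable.of_equiv {α β : Type} [Fintype α] [DecidableEq α] [Fintype β]
    [DecidableEq β] {r : ℕ} {A : Fin r → Matrix α α ℂ} {A' : Fin r → Matrix β β ℂ}
    {P : Matrix β α ℂ} {P' : Matrix α β ℂ} {Q : Matrix α β ℂ} {Q' : Matrix β α ℂ}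
    (hP : P * P' = 1) (hP' : P' * P = 1) (hQ : Q * Q' = 1) (hQ' : Q' * Q = 1)
    (h : ∀ i, P * A i * Q = A' i) (hA' : PencilDecomposable A') : PencilDecomposable A := by
  obtain ⟨ι, _, _, d, B, L, L', R, R', ⟨h1, h2⟩, ⟨h3, h4⟩, h5, h6⟩ := hA'
  refine ⟨ι, inferInstance, inferInstance, d, B, L * P, P' * L', Q * R, R' * Q',
    ⟨?_, ?_⟩, ⟨?_, ?_⟩, fun i => ?_, h6⟩
  · rw [Matrix.mul_assoc, ← Matrix.mul_assoc P, hP, Matrix.one_mul, h1]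
  · rw [Matrix.mul_assoc, ← Matrix.mul_assoc L', h2, Matrix.one_mul, hP']
  · rw [Matrix.mul_assoc, ← Matrix.mul_assoc R, h3, Matrix.one_mul, hQ]
  · rw [Matrix.mul_assoc, ← Matrix.mul_assoc Q', hQ', Matrix.one_mul, h4]
  · rw [← h5, ← h]
    simp only [Matrix.mul_assoc]

lemma PencilDecomposable.fromBlocks {α β : Type} [Fintype α] [DecidableEq α] [Fintype β]
    [DecidableEq β] {r : ℕ} {A : Fin r → Matrix α α ℂ} {A' : Fin r → Matrix β β ℂ}
    (hA : PencilDecomposable A) (hA' : PencilDecomposable A') :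
    PencilDecomposable fun i => Matrix.fromBlocks (A i) 0 0 (A' i) := by
  obtain ⟨ι₁, _, _, d₁, B₁, L₁, L₁', R₁, R₁', ⟨h1, h2⟩, ⟨h3, h4⟩, h5, h6⟩ := hA
  obtain ⟨ι₂, _, _, d₂, B₂, L₂, L₂', R₂, R₂', ⟨k1, k2⟩, ⟨k3, k4⟩, k5, k6⟩ := hA'
  let B : (j : ι₁ ⊕ ι₂) → Fin r →
      Matrix (Fin (Sum.elim d₁ d₂ j)) (Fin (Sum.elim d₁ d₂ j)) ℂ :=
    fun j => match j with
      | Sum.inl j => B₁ j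
      | Sum.inr j => B₂ j
  let E : (Σ j : ι₁ ⊕ ι₂, Fin (Sum.elim d₁ d₂ j)) ≃ (Σ j, Fin (d₁ j)) ⊕ (Σ j, Fin (d₂ j)) :=
    Equiv.sumSigmaDistrib fun j => Fin (Sum.elim d₁ d₂ j)
  have hEl : ∀ j x, E ⟨Sum.inl j, x⟩ = Sum.inl ⟨j, x⟩ := fun _ _ => rfl
  have hEr : ∀ j x, E ⟨Sum.inr j, x⟩ = Sum.inr ⟨j, x⟩ := fun _ _ => rfl
  have hB : ∀ i, Matrix.blockDiagonal' (fun j => B j i) =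
      (Matrix.fromBlocks (Matrix.blockDiagonal' fun j => B₁ j i) 0 0
        (Matrix.blockDiagonal' fun j => B₂ j i)).submatrix E E := by
    intro i
    ext ⟨j | j, x⟩ ⟨k | k, y⟩
    · by_cases hjk : j = k
      · subst hjk
        rw [Matrix.blockDiagonal'_apply_eq]
        exact (Matrix.blockDiagonal'_apply_eq (fun j => B₁ j i) j x y).symm
      · rw [Matrix.blockDiagonal'_apply_ne _ _ _ (by simpa using hjk)]
        exact (Matrix.blockDiagonal'_apply_ne (fun j => B₁ j i) x y hjk).symm
    · rw [Matrix.blockDiagonal'_apply_ne _ _ _ (by simp)]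
      simp [hEl, hEr]
    · rw [Matrix.blockDiagonal'_apply_ne _ _ _ (by simp)]
      simp [hEl, hEr]
    · by_cases hjk : j = k
      · subst hjk
        rw [Matrix.blockDiagonal'_apply_eq]
        exact (Matrix.blockDiagonal'_apply_eq (fun j => B₂ j i) j x y).symm
      · rw [Matrix.blockDiagonal'_apply_ne _ _ _ (by simpa using hjk)]
        exact (Matrix.blockDiagonal'_apply_ne (fun j => B₂ j i) x y hjk).symm
  refine ⟨ι₁ ⊕ ι₂, inferInstance, inferInstance, Sum.elim d₁ d₂, B,
    (Matrix.fromBlocks L₁ 0 0 L₂).submatrix E id, (Matrix.fromBlocks L₁' 0 0 L₂').submatrix id E,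
    (Matrix.fromBlocks R₁ 0 0 R₂).submatrix id E, (Matrix.fromBlocks R₁' 0 0 R₂').submatrix E id,
    ⟨?_, ?_⟩, ⟨?_, ?_⟩, fun i => ?_, ?_⟩
  · rw [Matrix.submatrix_mul _ _ E id E Function.bijective_id |>.symm]
    simp [Matrix.fromBlocks_multiply, h1, k1]
  · rw [Matrix.submatrix_mul _ _ id E id E.bijective |>.symm]
    simp [Matrix.fromBlocks_multiply, h2, k2]
  · rw [Matrix.submatrix_mul _ _ id E id E.bijective |>.symm]
    simp [Matrix.fromBlocks_multiply, h3, k3]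
  · rw [Matrix.submatrix_mul _ _ E id E Function.bijective_id |>.symm]
    simp [Matrix.fromBlocks_multiply, h4, k4]
  · have := Matrix.submatrix_mul (Matrix.fromBlocks L₁ 0 0 L₂)
      (Matrix.fromBlocks (A i) 0 0 (A' i)) E id id Function.bijective_id
    rw [Matrix.submatrix_id_id] at this
    rw [← this, Matrix.submatrix_mul _ _ E id E Function.bijective_id |>.symm, hB]
    simp [Matrix.fromBlocks_multiply, h5, k5]
  · rintro (j | j)
    · exact h6 j
    · exact k6 j

lemma PencilUnsplittable.decomposable {n r : ℕ} {A : Fin r → Matrix (Fin n) (Fin n) ℂ}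
    (hA : PencilUnsplittable A) : PencilDecomposable A := by
  let E : (Σ _ : Unit, Fin n) ≃ Fin n := Equiv.uniqueSigma _
  refine ⟨Unit, inferInstance, inferInstance, fun _ => n, fun _ => A,
    (1 : Matrix (Fin n) (Fin n) ℂ).submatrix E id, (1 : Matrix (Fin n) (Fin n) ℂ).submatrix id E,
    (1 : Matrix (Fin n) (Fin n) ℂ).submatrix id E, (1 : Matrix (Fin n) (Fin n) ℂ).submatrix E id,
    ⟨?_, ?_⟩, ⟨?_, ?_⟩, fun i => ?_, fun _ => hA⟩
  · rw [Matrix.submatrix_mul _ _ E id E Function.bijective_id |>.symm]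
    simp
  · rw [Matrix.submatrix_mul _ _ id E id E.bijective |>.symm]
    simp
  · rw [Matrix.submatrix_mul _ _ id E id E.bijective |>.symm]
    simp
  · rw [Matrix.submatrix_mul _ _ E id E Function.bijective_id |>.symm]
    simp
  · have := Matrix.submatrix_mul (1 : Matrix (Fin n) (Fin n) ℂ) (A i) E id id Function.bijective_id
    rw [Matrix.submatrix_id_id] at this
    rw [← this, Matrix.submatrix_mul _ _ E id E Function.bijective_id |>.symm]
    ext ⟨j, x⟩ ⟨k, y⟩
    have hE : ∀ j x, E ⟨j, x⟩ = x := fun _ _ => rfl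
    simp [hE, Matrix.blockDiagonal'_apply]

lemma PencilDecomposable.lrSemisimple {n r : ℕ} {A : Fin r → Matrix (Fin n) (Fin n) ℂ}
    (hA : PencilDecomposable A) : PencilLRSemisimple A := by
  obtain ⟨ι, _, _, d, B, L, L', R, R', ⟨h1, h2⟩, ⟨h3, h4⟩, h5, h6⟩ := hA
  let f : Fin (Fintype.card ι) ≃ ι := (Fintype.equivFin ι).symm
  let F : (Σ j : Fin (Fintype.card ι), Fin (d (f j))) ≃ Σ j, Fin (d j) :=
    Equiv.sigmaCongrLeft (β := fun j => Fin (d j)) f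
  have hcard : Fintype.card (Fin n) = Fintype.card (Σ j, Fin (d j)) := by
    exact Matrix.square_of_invertible L' L h2 h1
  let e₀ : Fin n ≃ Σ j, Fin (d j) := Fintype.equivOfCardEq hcard
  refine ⟨L.submatrix e₀ id, R.submatrix id e₀, ?_, ?_, Fintype.card ι, fun j => d (f j),
    fun j => B (f j), e₀.trans F.symm, fun i => ?_, fun j => h6 (f j)⟩
  · refine IsUnit.of_mul_eq_one (L'.submatrix id e₀) ?_
    rw [Matrix.submatrix_mul _ _ e₀ id e₀ Function.bijective_id |>.symm, h1]
    simp
  · refine IsUnit.of_mul_eq_one (R'.submatrix e₀ id) ?_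
    rw [Matrix.submatrix_mul _ _ id e₀ id e₀.bijective |>.symm, h3]
    simp
  · have := Matrix.submatrix_mul L (A i) e₀ id id Function.bijective_id
    rw [Matrix.submatrix_id_id] at this
    rw [← this, Matrix.submatrix_mul _ _ e₀ id e₀ Function.bijective_id |>.symm, h5]
    have hF : (Matrix.blockDiagonal' fun j => B j i) =
        (Matrix.blockDiagonal' fun j => B (f j) i).submatrix F.symm F.symm := by
      rw [← Matrix.submatrix_id_id (Matrix.blockDiagonal' fun j => B j i), ← F.self_comp_symm,
        ← Matrix.submatrix_submatrix]
      congr 1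
      ext ⟨j, x⟩ ⟨k, y⟩
      by_cases hjk : j = k
      · subst hjk
        simp [F]
      · rw [Matrix.blockDiagonal'_apply_ne _ _ _ hjk]
        simp [F, Matrix.blockDiagonal'_apply_ne _ _ _ (f.injective.ne hjk)]
    rw [hF]
    rfl

/-- A unitary change of coordinates which is adapted to a given subspace. -/
lemma exists_adapted_unitary {n s t : ℕ} (hn : s + t = n) (R : Submodule ℂ (Fin n → ℂ))
    (hR : Module.finrank ℂ R = s) :
    ∃ W : Matrix (Fin n) (Fin s ⊕ Fin t) ℂ, Wᴴ * W = 1 ∧ W * Wᴴ = 1 ∧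
      (∀ k, W.col (Sum.inl k) ∈ R) ∧ ∀ x ∈ R, ∀ j, (Wᴴ *ᵥ x) (Sum.inr j) = 0 := by
  let φ : EuclideanSpace ℂ (Fin n) ≃ₗ[ℂ] (Fin n → ℂ) := WithLp.linearEquiv 2 ℂ (Fin n → ℂ)
  let R' : Submodule ℂ (EuclideanSpace ℂ (Fin n)) := R.comap φ.toLinearMap
  have hR' : Module.finrank ℂ R' = s := by
    rw [← hR]
    exact (φ.ofSubmodule' R).finrank_eq
  let bR : OrthonormalBasis (Fin s) ℂ R' := (stdOrthonormalBasis ℂ R').reindex (finCongr hR')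
  let v : Fin s ⊕ Fin t → EuclideanSpace ℂ (Fin n) := Sum.elim (fun k => (bR k : _)) 0
  have hv : Orthonormal ℂ ((Set.range Sum.inl).domRestrict v) := by
    have : Orthonormal ℂ fun k => (bR k : EuclideanSpace ℂ (Fin n)) :=
      bR.orthonormal.comp_linearIsometry R'.subtypeₗᵢ
    rw [orthonormal_iff_ite] at this ⊢
    rintro ⟨_, k, rfl⟩ ⟨_, l, rfl⟩
    simpa [v, Subtype.ext_iff] using! this k l
  obtain ⟨b, hb⟩ := hv.exists_orthonormalBasis_extension_of_card_eq (by simp [hn])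
  have hbl : ∀ k, b (Sum.inl k) = bR k := fun k => hb _ ⟨k, rfl⟩
  have h1 : (Matrix.of fun i k => b k i)ᴴ * (Matrix.of fun i k => b k i) = 1 := by
    ext k l
    have := orthonormal_iff_ite.1 b.orthonormal k l
    simp only [PiLp.inner_apply, RCLike.inner_apply] at this
    simp [Matrix.mul_apply, Matrix.one_apply, ← this, mul_comm]
  refine ⟨Matrix.of fun i k => b k i, h1, ?_, fun k => ?_, fun x hx j => ?_⟩
  · exact (Matrix.mul_eq_one_comm_of_card_eq _ _ _ (by simp [hn])).1 h1
  · have := (bR k).2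
    rw [← hbl] at this
    exact this
  · have hx' : φ.symm x ∈ R' := by simpa [R'] using hx
    have h2 : inner ℂ (b (Sum.inr j)) (φ.symm x) = 0 := by
      have h3 := congrArg (Subtype.val) (bR.sum_repr ⟨φ.symm x, hx'⟩)
      simp only at h3
      rw [← h3]
      simp only [Submodule.coe_sum, Submodule.coe_smul, inner_sum, inner_smul_right, ← hbl]
      refine Finset.sum_eq_zero fun k _ => ?_
      rw [b.orthonormal.2 (by simp), mul_zero]
    rw [← h2]
    simp [Matrix.mulVec, dotProduct, PiLp.inner_apply, φ, mul_comm]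

/-- A doubly stochastic pencil which is block upper triangular with square diagonal blocks is
block diagonal, and its diagonal blocks are doubly stochastic. -/
lemma doublyStochastic_fromBlocks {α β ι : Type*} [Fintype α] [DecidableEq α] [Fintype β]
    [DecidableEq β] [Fintype ι] {P : ι → Matrix α α ℂ} {Q : ι → Matrix α β ℂ}
    {S : ι → Matrix β β ℂ}
    (h1 : ∑ i, Matrix.fromBlocks (P i) (Q i) 0 (S i) * (Matrix.fromBlocks (P i) (Q i) 0 (S i))ᴴ = 1)
    (h2 : ∑ i, (Matrix.fromBlocks (P i) (Q i) 0 (S i))ᴴ *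
      Matrix.fromBlocks (P i) (Q i) 0 (S i) = 1) :
    (∀ i, Q i = 0) ∧ (∑ i, P i * (P i)ᴴ = 1 ∧ ∑ i, (P i)ᴴ * P i = 1) ∧
      ∑ i, S i * (S i)ᴴ = 1 ∧ ∑ i, (S i)ᴴ * S i = 1 := by
  have sum_blocks : ∀ (a : ι → Matrix α α ℂ) (b : ι → Matrix α β ℂ) (c : ι → Matrix β α ℂ)
      (d : ι → Matrix β β ℂ), ∑ i, Matrix.fromBlocks (a i) (b i) (c i) (d i) =
        Matrix.fromBlocks (∑ i, a i) (∑ i, b i) (∑ i, c i) (∑ i, d i) := by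
    intro a b c d
    ext (x | x) (y | y) <;> simp [Matrix.sum_apply]
  simp only [Matrix.fromBlocks_conjTranspose, Matrix.fromBlocks_multiply, sum_blocks] at h1 h2
  rw [← Matrix.fromBlocks_one, Matrix.fromBlocks_inj] at h1 h2
  simp only [Matrix.conjTranspose_zero, Matrix.mul_zero, Matrix.zero_mul, zero_add, add_zero,
    Finset.sum_add_distrib] at h1 h2
  obtain ⟨a1, -, -, a4⟩ := h1
  obtain ⟨b1, -, -, b4⟩ := h2
  have ht : ∑ i, (P i * (P i)ᴴ).trace = ∑ i, ((P i)ᴴ * P i).trace :=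
    Finset.sum_congr rfl fun i _ => Matrix.trace_mul_comm _ _
  have hQ : ∑ i, (Q i * (Q i)ᴴ).trace = 0 := by
    have := congrArg Matrix.trace (a1.trans b1.symm)
    rw [Matrix.trace_add, Matrix.trace_sum, Matrix.trace_sum, Matrix.trace_sum, ht] at this
    simpa using this
  have hQ0 : ∀ i, Q i = 0 := fun i => by
    have := (Finset.sum_eq_zero_iff_of_nonneg (fun i _ =>
      (Matrix.posSemidef_self_mul_conjTranspose (Q i)).trace_nonneg)).1 hQ i (Finset.mem_univ i)
    rwa [Matrix.trace_mul_conjTranspose_self_eq_zero_iff] at this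
  simp only [hQ0, Matrix.conjTranspose_zero, Matrix.mul_zero, Finset.sum_const_zero, zero_add,
    add_zero] at a1 b4
  exact ⟨hQ0, ⟨a1, b1⟩, a4, b4⟩

/-- Doubly stochastic pencils decompose into unsplittable ones. -/
lemma PencilDecomposable.of_doublyStochastic {n r : ℕ} {A : Fin r → Matrix (Fin n) (Fin n) ℂ}
    (h1 : ∑ i, A i * (A i)ᴴ = 1) (h2 : ∑ i, (A i)ᴴ * A i = 1) : PencilDecomposable A := by
  induction n using Nat.strong_induction_on with
  | _ n ih =>
  rcases Nat.eq_zero_or_pos n with rfl | hn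
  · exact ⟨Empty, inferInstance, inferInstance, fun j => j.elim, fun j => j.elim, 0, 0, 0, 0,
      ⟨Subsingleton.elim _ _, Subsingleton.elim _ _⟩,
      ⟨Subsingleton.elim _ _, Subsingleton.elim _ _⟩,
      fun i => Subsingleton.elim _ _, fun j => j.elim⟩
  by_cases hs : PencilSplittable A
  · obtain ⟨R, L, hR1, hR2, hRL, hAR⟩ := hs
    obtain ⟨s, hRs⟩ : ∃ s, Module.finrank ℂ R = s := ⟨_, rfl⟩
    obtain ⟨t, hst⟩ : ∃ t, s + t = n := ⟨n - s, by omega⟩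
    obtain ⟨W, hW1, hW2, hWR, -⟩ := exists_adapted_unitary hst R hRs
    obtain ⟨V, hV1, hV2, -, hVL⟩ := exists_adapted_unitary hst L (hRL ▸ hRs)
    let A' : Fin r → Matrix (Fin s ⊕ Fin t) (Fin s ⊕ Fin t) ℂ := fun i => Vᴴ * A i * W
    have hA' : ∀ i, A' i = Matrix.fromBlocks (A' i).toBlocks₁₁ (A' i).toBlocks₁₂ 0
        (A' i).toBlocks₂₂ := by
      intro i
      have : (A' i).toBlocks₂₁ = 0 := by
        ext j k
        have h3 := hVL (A i *ᵥ W.col (Sum.inl k))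
          (hAR i (Submodule.mem_map_of_mem (hWR k))) j
        rw [Matrix.mulVec_mulVec] at h3
        exact h3
      rw [← this, Matrix.fromBlocks_toBlocks]
    have d1 : ∑ i, A' i * (A' i)ᴴ = 1 := by
      have : ∀ i, A' i * (A' i)ᴴ = Vᴴ * (A i * (A i)ᴴ) * V := fun i => by
        simp only [A', Matrix.conjTranspose_mul, Matrix.conjTranspose_conjTranspose]
        rw [Matrix.mul_assoc, ← Matrix.mul_assoc W, hW2, Matrix.one_mul]
        simp only [Matrix.mul_assoc]
      rw [Finset.sum_congr rfl fun i _ => this i, ← Matrix.sum_mul, ← Matrix.mul_sum, h1,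
        Matrix.mul_one, hV1]
    have d2 : ∑ i, (A' i)ᴴ * A' i = 1 := by
      have : ∀ i, (A' i)ᴴ * A' i = Wᴴ * ((A i)ᴴ * A i) * W := fun i => by
        simp only [A', Matrix.conjTranspose_mul, Matrix.conjTranspose_conjTranspose]
        rw [Matrix.mul_assoc, Matrix.mul_assoc (A i)ᴴ, Matrix.mul_assoc Vᴴ, ← Matrix.mul_assoc V,
          hV2, Matrix.one_mul]
        simp only [Matrix.mul_assoc]
      rw [Finset.sum_congr rfl fun i _ => this i, ← Matrix.sum_mul, ← Matrix.mul_sum, h2,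
        Matrix.mul_one, hW1]
    rw [Finset.sum_congr rfl fun i _ => by rw [hA' i]] at d1 d2
    obtain ⟨hQ, ⟨p1, p2⟩, q1, q2⟩ := doublyStochastic_fromBlocks d1 d2
    refine PencilDecomposable.of_equiv hV1 hV2 hW2 hW1 (fun i => ?_)
      ((ih s (by omega) p1 p2).fromBlocks (ih t (by omega) q1 q2))
    exact (hA' i).trans (by rw [hQ])
  · refine PencilUnsplittable.decomposable ⟨?_, hs⟩
    by_contra! h0
    simp only [h0, Matrix.zero_mul, Finset.sum_const_zero] at h1
    have := congrFun (congrFun h1 ⟨0, hn⟩) ⟨0, hn⟩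
    simp at this

/-- A symmetrically scalable Hermitian pencil is LR-semisimple. -/
lemma lrSemisimple_of_symmetric_scaling {n r : ℕ} {A : Fin r → Matrix (Fin n) (Fin n) ℂ}
    (hA : ∀ i, (A i).IsHermitian) {C : Matrix (Fin n) (Fin n) ℂ} (hC : C.PosDef)
    (h : ∑ i, A i * C * A i = C⁻¹) : PencilLRSemisimple A := by
  obtain ⟨g, hg, rfl, -⟩ := exists_posDef_sqrt hC
  have hgu : IsUnit g.det := (Matrix.isUnit_iff_isUnit_det _).1 hg.isUnit
  have a1 : g⁻¹ * g = 1 := Matrix.nonsing_inv_mul _ hgu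
  have a2 : g * g⁻¹ = 1 := Matrix.mul_nonsing_inv _ hgu
  have hA' : ∀ i, (g * A i * g)ᴴ = g * A i * g := fun i => by
    simp only [Matrix.conjTranspose_mul, hg.1.eq, (hA i).eq, Matrix.mul_assoc]
  have key : ∑ i, (g * A i * g) * (g * A i * g) = 1 := by
    have : ∀ i, (g * A i * g) * (g * A i * g) = g * (A i * (g * g) * A i) * g := fun i => by
      simp only [Matrix.mul_assoc]
    rw [Finset.sum_congr rfl fun i _ => this i, ← Matrix.sum_mul, ← Matrix.mul_sum, h,
      Matrix.mul_inv_rev, ← Matrix.mul_assoc, a2, Matrix.one_mul, a1]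
  refine PencilDecomposable.lrSemisimple (PencilDecomposable.of_equiv a2 a1 a2 a1 (fun i => rfl)
    (PencilDecomposable.of_doublyStochastic ?_ ?_))
  · simpa only [hA'] using key
  · simpa only [hA'] using key

lemma exists_sorted_diagonalization {n : ℕ} {P : Matrix (Fin n) (Fin n) ℂ} (hP : P.PosSemidef) :
    ∃ (V : Matrix (Fin n) (Fin n) ℂ) (d : Fin n → ℝ), V ∈ Matrix.unitaryGroup (Fin n) ℂ ∧
      Monotone d ∧ (∀ i, 0 ≤ d i) ∧ P = V * Matrix.diagonal (fun i => (d i : ℂ)) * Vᴴ := by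
  let σ := Tuple.sort hP.1.eigenvalues
  let U : Matrix (Fin n) (Fin n) ℂ := hP.1.eigenvectorUnitary
  have hU : U * Uᴴ = 1 := Matrix.mem_unitaryGroup_iff.1 hP.1.eigenvectorUnitary.2
  have hP' : P = U * Matrix.diagonal (fun i => (hP.1.eigenvalues i : ℂ)) * Uᴴ := by
    conv_lhs => rw [hP.1.spectral_theorem]
    rw [Unitary.conjStarAlgAut_apply]
    rfl
  refine ⟨U.submatrix id σ, hP.1.eigenvalues ∘ σ, ?_, Tuple.monotone_sort _,
    fun i => hP.eigenvalues_nonneg _, ?_⟩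
  · rw [Matrix.mem_unitaryGroup_iff, Matrix.star_eq_conjTranspose, Matrix.conjTranspose_submatrix,
      Matrix.submatrix_mul_equiv, hU]
    rfl
  · have h1 : Matrix.diagonal (fun i => ((hP.1.eigenvalues ∘ σ) i : ℂ)) =
        (Matrix.diagonal (fun i => (hP.1.eigenvalues i : ℂ))).submatrix σ σ := by
      rw [Matrix.submatrix_diagonal_equiv]
      rfl
    rw [h1, Matrix.conjTranspose_submatrix, Matrix.submatrix_mul_equiv, Matrix.submatrix_mul_equiv,
      ← hP']
    rfl

lemma det_eq_prod_of_diagonalization {n : ℕ} {P V : Matrix (Fin n) (Fin n) ℂ} {d : Fin n → ℝ}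
    (hV : V ∈ Matrix.unitaryGroup (Fin n) ℂ)
    (hP : P = V * Matrix.diagonal (fun i => (d i : ℂ)) * Vᴴ) : P.det = ((∏ i, d i : ℝ) : ℂ) := by
  have h1 : V.det * Vᴴ.det = 1 := by
    rw [← Matrix.det_mul, ← Matrix.star_eq_conjTranspose, Matrix.mem_unitaryGroup_iff.1 hV,
      Matrix.det_one]
  rw [hP, Matrix.det_mul, Matrix.det_mul, Matrix.det_diagonal, mul_right_comm, h1, one_mul]
  push_cast
  rfl

lemma trace_eq_sum_of_diagonalization {n : ℕ} {P V : Matrix (Fin n) (Fin n) ℂ} {d : Fin n → ℝ}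
    (hV : V ∈ Matrix.unitaryGroup (Fin n) ℂ)
    (hP : P = V * Matrix.diagonal (fun i => (d i : ℂ)) * Vᴴ) : P.trace = ((∑ i, d i : ℝ) : ℂ) := by
  rw [hP, Matrix.mul_assoc, Matrix.trace_mul_comm, Matrix.mul_assoc, ← Matrix.star_eq_conjTranspose,
    Matrix.mem_unitaryGroup_iff'.1 hV, Matrix.mul_one, Matrix.trace_diagonal]
  push_cast
  rfl

/-- If `d` and `e` are increasing with product one, and the products of suitable pairs of entries
are at most `T`, then all entries of `d` are bounded in terms of `T`. -/
lemma le_pow_of_sorted_products {m : ℕ} {d e : Fin (m + 1) → ℝ} (hd : Monotone d)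
    (he : Monotone e) (hd0 : ∀ i, 0 ≤ d i) (he0 : ∀ i, 0 ≤ e i) (hd1 : ∏ i, d i = 1)
    (he1 : ∏ i, e i = 1) {T : ℝ} (hT : 1 ≤ T)
    (h : ∀ i : Fin m, d i.succ * e i.rev.succ ≤ T) (k : Fin (m + 1)) : d k ≤ T ^ (m + 1) := by
  have hle : ∀ {f : Fin (m + 1) → ℝ}, Monotone f → (∀ i, 0 ≤ f i) → ∏ i, f i = 1 → f 0 ≤ 1 := by
    intro f hf hf0 hf1
    by_contra! hlt
    have : ∏ i : Fin (m + 1), (1 : ℝ) < ∏ i, f i :=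
      Finset.prod_lt_prod_of_nonempty (fun _ _ => one_pos)
        (fun i _ => hlt.trans_le (hf (Fin.zero_le i))) Finset.univ_nonempty
    rw [hf1, Finset.prod_const_one] at this
    exact lt_irrefl _ this
  have hprod : 1 ≤ d 0 * e 0 * T ^ m := by
    have h1 : (1 : ℝ) = d 0 * e 0 * ∏ i : Fin m, d i.succ * e i.rev.succ := by
      have h2 : ∏ i : Fin m, e i.rev.succ = ∏ i : Fin m, e i.succ :=
        Equiv.prod_comp Fin.revPerm fun i : Fin m => e i.succ
      rw [Finset.prod_mul_distrib, h2, mul_mul_mul_comm, ← Fin.prod_univ_succ, ← Fin.prod_univ_succ,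
        hd1, he1, mul_one]
    calc (1 : ℝ) = d 0 * e 0 * ∏ i : Fin m, d i.succ * e i.rev.succ := h1
      _ ≤ d 0 * e 0 * ∏ _i : Fin m, T := by
        refine mul_le_mul_of_nonneg_left ?_ (mul_nonneg (hd0 _) (he0 _))
        exact Finset.prod_le_prod (fun i _ => mul_nonneg (hd0 _) (he0 _)) fun i _ => h i
      _ = _ := by simp
  have hd0' := hle hd hd0 hd1
  have he0' := hle he he0 he1
  have hT0 : 0 ≤ T ^ m := pow_nonneg (zero_le_one.trans hT) m
  have key : d k * e 0 ≤ T := by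
    rcases Nat.eq_zero_or_pos m with rfl | hm
    · obtain rfl : k = 0 := Fin.ext (by simp)
      nlinarith [hd0 0, he0 0]
    · let l : Fin m := ⟨m - 1, by omega⟩
      have hk : k ≤ l.succ := by
        rw [Fin.le_def]
        simp [l]
        omega
      calc d k * e 0 ≤ d l.succ * e l.rev.succ :=
            mul_le_mul (hd hk) (he (Fin.zero_le _)) (he0 _) (hd0 _)
        _ ≤ T := h l
  calc d k ≤ d k * (d 0 * e 0 * T ^ m) := le_mul_of_one_le_right (hd0 k) hprod
    _ = (d k * e 0) * d 0 * T ^ m := by ring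
    _ ≤ T * 1 * T ^ m := by
      refine mul_le_mul_of_nonneg_right ?_ hT0
      exact mul_le_mul key hd0' (hd0 0) (zero_le_one.trans hT)
    _ = T ^ (m + 1) := by ring

lemma trace_conjTranspose_mul_self_eq {α β : Type*} [Fintype α] [Fintype β] (M : Matrix α β ℂ) :
    (Mᴴ * M).trace = ((∑ j, ∑ k, ‖M j k‖ ^ 2 : ℝ) : ℂ) := by
  simp only [Matrix.trace, Matrix.diag_apply, Matrix.mul_apply, Matrix.conjTranspose_apply]
  rw [Finset.sum_comm]
  push_cast
  refine Finset.sum_congr rfl fun j _ => Finset.sum_congr rfl fun k _ => ?_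
  exact RCLike.conj_mul _

lemma trace_conjTranspose_mul_diagonal {α β : Type*} [Fintype α] [Fintype β] [DecidableEq α]
    [DecidableEq β] (M : Matrix α β ℂ) (d : α → ℝ) (e : β → ℝ) :
    (Mᴴ * Matrix.diagonal (fun i => (d i : ℂ)) * M * Matrix.diagonal (fun i => (e i : ℂ))).trace =
      ((∑ j, ∑ k, d j * e k * ‖M j k‖ ^ 2 : ℝ) : ℂ) := by
  simp only [Matrix.trace, Matrix.diag_apply, Matrix.mul_diagonal]
  have h1 : ∀ k, (Mᴴ * Matrix.diagonal (fun i => (d i : ℂ)) * M) k k =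
      ∑ j, star (M j k) * d j * M j k := by
    intro k
    rw [Matrix.mul_apply]
    refine Finset.sum_congr rfl fun j _ => ?_
    rw [Matrix.mul_diagonal, Matrix.conjTranspose_apply]
  simp only [h1, Finset.sum_mul]
  rw [Finset.sum_comm]
  push_cast
  refine Finset.sum_congr rfl fun j _ => Finset.sum_congr rfl fun k _ => ?_
  have h2 : star (M j k) * M j k = (‖M j k‖ : ℂ) ^ 2 := RCLike.conj_mul (M j k)
  rw [← h2]
  ring

lemma isCompact_setOf_entries_le {α β : Type*} (R : ℝ) :
    IsCompact {M : Matrix α β ℂ | ∀ i j, ‖M i j‖ ≤ R} := by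
  have h : {M : Matrix α β ℂ | ∀ i j, ‖M i j‖ ≤ R} =
      Set.pi Set.univ fun _ => Set.pi Set.univ fun _ => Metric.closedBall (0 : ℂ) R := by
    ext M
    exact ⟨fun h i _ j _ => mem_closedBall_zero_iff.2 (h i j),
      fun h i j => mem_closedBall_zero_iff.1 (h i trivial j trivial)⟩
  rw [h]
  exact isCompact_univ_pi fun i => isCompact_univ_pi fun j => isCompact_closedBall 0 R

lemma isCompact_unitaryGroup (n : ℕ) :
    IsCompact {V : Matrix (Fin n) (Fin n) ℂ | V ∈ Matrix.unitaryGroup (Fin n) ℂ} := by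
  refine (isCompact_setOf_entries_le 1).of_isClosed_subset ?_
    fun V hV i j => entry_norm_bound_of_unitary hV i j
  simp only [Matrix.mem_unitaryGroup_iff, Matrix.star_eq_conjTranspose]
  exact isClosed_eq (continuous_id.matrix_mul continuous_id.matrix_conjTranspose) continuous_const

/-- In an unsplittable pencil, no zero blocks of complementary dimensions appear in any pair of
orthonormal bases. -/
lemma PencilUnsplittable.exists_entry_ne_zero {n r : ℕ} {B : Fin r → Matrix (Fin n) (Fin n) ℂ}
    (hB : PencilUnsplittable B) {V W : Matrix (Fin n) (Fin n) ℂ}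
    (hV : V ∈ Matrix.unitaryGroup (Fin n) ℂ) (hW : W ∈ Matrix.unitaryGroup (Fin n) ℂ)
    {S K : Finset (Fin n)} (hS : S.Nonempty) (hK : K.Nonempty) (hSK : S.card + K.card = n) :
    ∃ i, ∃ j ∈ K, ∃ k ∈ S, (Vᴴ * B i * W) j k ≠ 0 := by
  by_contra! hzero
  have hli : ∀ {U : Matrix (Fin n) (Fin n) ℂ}, U ∈ Matrix.unitaryGroup (Fin n) ℂ →
      ∀ Q : Finset (Fin n), Module.finrank ℂ
        (Submodule.span ℂ (Set.range fun q : Q => U.col q)) = Q.card := by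
    intro U hU Q
    have h1 : LinearIndependent ℂ U.col :=
      Matrix.linearIndependent_cols_iff_isUnit.2
        (.of_mul_eq_one _ (Matrix.mem_unitaryGroup_iff.1 hU))
    have h2 := finrank_span_eq_card (h1.comp (fun q : Q => (q : Fin n)) Subtype.val_injective)
    rwa [Fintype.card_coe] at h2
  have hKc : Kᶜ.card = S.card := by
    rw [Finset.card_compl, Fintype.card_fin]
    omega
  refine hB.2 ⟨Submodule.span ℂ (Set.range fun q : S => W.col q),
    Submodule.span ℂ (Set.range fun q : (Kᶜ : Finset (Fin n)) => V.col q), ?_, ?_, ?_, fun i => ?_⟩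
  · rw [hli hW]
    exact hS.card_pos
  · rw [hli hW]
    have := hK.card_pos
    omega
  · rw [hli hW, hli hV, hKc]
  · rw [Submodule.map_span, Submodule.span_le]
    rintro _ ⟨_, ⟨⟨k, hk⟩, rfl⟩, rfl⟩
    have h1 : B i * W = V * (Vᴴ * B i * W) := by
      have : V * Vᴴ = 1 := Matrix.mem_unitaryGroup_iff.1 hV
      rw [← Matrix.mul_assoc, ← Matrix.mul_assoc, this, Matrix.one_mul]
    have h2 : (B i).mulVecLin (W.col k) = ∑ j, (Vᴴ * B i * W) j k • V.col j := by
      ext l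
      have := congrFun (congrFun h1 l) k
      simp only [Matrix.mulVecLin_apply, Finset.sum_apply, Pi.smul_apply, Matrix.col_apply,
        smul_eq_mul]
      rw [Matrix.mul_apply, Matrix.mul_apply] at this
      simp only [Matrix.mulVec, dotProduct, Matrix.col_apply]
      rw [this]
      exact Finset.sum_congr rfl fun j _ => mul_comm _ _
    rw [SetLike.mem_coe, h2]
    refine Submodule.sum_mem _ fun j _ => ?_
    by_cases hj : j ∈ K
    · rw [hzero i j hj k hk, zero_smul]
      exact Submodule.zero_mem _
    · exact Submodule.smul_mem _ _ (Submodule.subset_span ⟨⟨j, by simpa using hj⟩, rfl⟩)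

/-- The sum of the squared Frobenius norms of the matrices of a pencil. -/
noncomputable def pencilNormSq {n r : ℕ} (B : Fin r → Matrix (Fin n) (Fin n) ℂ) : ℝ :=
  ∑ i, ∑ j, ∑ k, ‖B i j k‖ ^ 2

lemma trace_sum_conjTranspose_mul_self {n r : ℕ} (B : Fin r → Matrix (Fin n) (Fin n) ℂ) :
    (∑ i, (B i)ᴴ * B i).trace = (pencilNormSq B : ℂ) := by
  rw [Matrix.trace_sum, pencilNormSq, Complex.ofReal_sum]
  exact Finset.sum_congr rfl fun i _ => trace_conjTranspose_mul_self_eq (B i)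

lemma trace_sum_mul_conjTranspose_self {n r : ℕ} (B : Fin r → Matrix (Fin n) (Fin n) ℂ) :
    (∑ i, B i * (B i)ᴴ).trace = (pencilNormSq B : ℂ) := by
  rw [← trace_sum_conjTranspose_mul_self, Matrix.trace_sum, Matrix.trace_sum]
  exact Finset.sum_congr rfl fun i _ => Matrix.trace_mul_comm _ _

lemma eq_zero_of_pencilNormSq_eq_zero {n r : ℕ} {B : Fin r → Matrix (Fin n) (Fin n) ℂ}
    (h : pencilNormSq B = 0) (i : Fin r) : B i = 0 := by
  ext j k
  have h1 := (Finset.sum_eq_zero_iff_of_nonneg fun i _ => by positivity).1 h i (Finset.mem_univ i)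
  have h2 := (Finset.sum_eq_zero_iff_of_nonneg fun i _ => by positivity).1 h1 j (Finset.mem_univ j)
  have h3 := (Finset.sum_eq_zero_iff_of_nonneg fun i _ => by positivity).1 h2 k (Finset.mem_univ k)
  simpa using h3

lemma PencilUnsplittable.exists_pos_le_block {n r : ℕ} {B : Fin r → Matrix (Fin n) (Fin n) ℂ}
    (hB : PencilUnsplittable B) {S K : Finset (Fin n)} (hS : S.Nonempty) (hK : K.Nonempty)
    (hSK : S.card + K.card = n) :
    ∃ δ : ℝ, 0 < δ ∧ ∀ V ∈ Matrix.unitaryGroup (Fin n) ℂ, ∀ W ∈ Matrix.unitaryGroup (Fin n) ℂ,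
      δ ≤ ∑ i, ∑ j ∈ K, ∑ k ∈ S, ‖(Vᴴ * B i * W) j k‖ ^ 2 := by
  obtain ⟨F, hFdef⟩ : ∃ F : Matrix (Fin n) (Fin n) ℂ × Matrix (Fin n) (Fin n) ℂ → ℝ,
      F = fun p => ∑ i, ∑ j ∈ K, ∑ k ∈ S, ‖(p.1ᴴ * B i * p.2) j k‖ ^ 2 := ⟨_, rfl⟩
  have hFapp : ∀ V W, F (V, W) = ∑ i, ∑ j ∈ K, ∑ k ∈ S, ‖(Vᴴ * B i * W) j k‖ ^ 2 :=
    fun V W => by rw [hFdef]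
  have hF : Continuous F := by
    rw [hFdef]
    refine continuous_finsetSum _ fun i _ => continuous_finsetSum _ fun j _ =>
      continuous_finsetSum _ fun k _ => ?_
    exact ((((continuous_fst.matrix_conjTranspose.matrix_mul continuous_const).matrix_mul
      continuous_snd).matrix_elem j k).norm).pow 2
  obtain ⟨⟨V₀, W₀⟩, ⟨hV₀, hW₀⟩, hmin⟩ :=
    ((isCompact_unitaryGroup n).prod (isCompact_unitaryGroup n)).exists_isMinOn
      ⟨(1, 1), one_mem (Matrix.unitaryGroup (Fin n) ℂ), one_mem (Matrix.unitaryGroup (Fin n) ℂ)⟩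
      hF.continuousOn
  refine ⟨F (V₀, W₀), ?_, fun V hV W hW => ?_⟩
  swap
  · rw [← hFapp]
    exact isMinOn_iff.1 hmin (V, W) (Set.mk_mem_prod hV hW)
  rw [hFapp]
  obtain ⟨i, j, hj, k, hk, hne⟩ := hB.exists_entry_ne_zero hV₀ hW₀ hS hK hSK
  refine Finset.sum_pos' (fun i _ => Finset.sum_nonneg fun j _ => Finset.sum_nonneg fun k _ =>
    sq_nonneg _) ⟨i, Finset.mem_univ i, ?_⟩
  refine Finset.sum_pos' (fun j _ => Finset.sum_nonneg fun k _ => sq_nonneg _) ⟨j, hj, ?_⟩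
  exact Finset.sum_pos' (fun k _ => sq_nonneg _) ⟨k, hk, pow_pos (norm_pos_iff.2 hne) 2⟩

/-- The function `(g, h) ↦ ∑ᵢ ‖g Bᵢ h‖²` in terms of the spectral decompositions of `gᴴ g` and
`h hᴴ`. -/
lemma pencilNormSq_of_diagonalization {n r : ℕ} (B : Fin r → Matrix (Fin n) (Fin n) ℂ)
    {g h V W : Matrix (Fin n) (Fin n) ℂ} {d e : Fin n → ℝ}
    (hg : gᴴ * g = V * Matrix.diagonal (fun i => (d i : ℂ)) * Vᴴ)
    (hh : h * hᴴ = W * Matrix.diagonal (fun i => (e i : ℂ)) * Wᴴ) :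
    pencilNormSq (fun i => g * B i * h) =
      ∑ i, ∑ j, ∑ k, d j * e k * ‖(Vᴴ * B i * W) j k‖ ^ 2 := by
  refine Finset.sum_congr rfl fun i _ => ?_
  apply Complex.ofReal_injective
  rw [← trace_conjTranspose_mul_diagonal, ← trace_conjTranspose_mul_self_eq]
  calc ((g * B i * h)ᴴ * (g * B i * h)).trace = ((B i)ᴴ * (gᴴ * g) * B i * (h * hᴴ)).trace := by
        simp only [Matrix.conjTranspose_mul, Matrix.mul_assoc]
        rw [Matrix.trace_mul_comm]
        simp only [Matrix.mul_assoc]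
    _ = _ := by
        rw [hg, hh, ← Matrix.mul_assoc _ _ Wᴴ, Matrix.trace_mul_comm]
        simp only [Matrix.conjTranspose_mul, Matrix.conjTranspose_conjTranspose, Matrix.mul_assoc]

lemma entries_le_of_trace {n : ℕ} {M : Matrix (Fin n) (Fin n) ℂ} {d : Fin n → ℝ} {c : ℝ}
    (hd : ∀ i, d i ≤ c) (h : (Mᴴ * M).trace = ((∑ i, d i : ℝ) : ℂ)) (j k : Fin n) :
    ‖M j k‖ ≤ n * c + 1 := by
  rw [trace_conjTranspose_mul_self_eq] at h
  have h1 : ∑ j, ∑ k, ‖M j k‖ ^ 2 = ∑ i, d i := Complex.ofReal_injective h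
  have h2 : ‖M j k‖ ^ 2 ≤ ∑ k, ‖M j k‖ ^ 2 :=
    Finset.single_le_sum (f := fun k => ‖M j k‖ ^ 2) (fun i _ => by positivity) (Finset.mem_univ k)
  have h3 : ∑ k, ‖M j k‖ ^ 2 ≤ ∑ j, ∑ k, ‖M j k‖ ^ 2 :=
    Finset.single_le_sum (f := fun j => ∑ k, ‖M j k‖ ^ 2) (fun i _ => by positivity)
      (Finset.mem_univ j)
  have h4 : ∑ i, d i ≤ n * c := by
    refine (Finset.sum_le_sum fun i _ => hd i).trans_eq ?_
    simp
  nlinarith [norm_nonneg (M j k)]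

lemma PencilUnsplittable.exists_bound {m r : ℕ}
    {B : Fin r → Matrix (Fin (m + 1)) (Fin (m + 1)) ℂ} (hB : PencilUnsplittable B) (c : ℝ) :
    ∃ R : ℝ, ∀ g h : Matrix (Fin (m + 1)) (Fin (m + 1)) ℂ, g.det = 1 → h.det = 1 →
      pencilNormSq (fun i => g * B i * h) ≤ c →
        (∀ j k, ‖g j k‖ ≤ R) ∧ ∀ j k, ‖h j k‖ ≤ R := by
  have hblock : ∀ l : Fin m, ∃ δ : ℝ, 0 < δ ∧ ∀ V ∈ Matrix.unitaryGroup (Fin (m + 1)) ℂ,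
      ∀ W ∈ Matrix.unitaryGroup (Fin (m + 1)) ℂ, δ ≤ ∑ i, ∑ j ∈ Finset.Ici l.succ,
        ∑ k ∈ Finset.Ici l.rev.succ, ‖(Vᴴ * B i * W) j k‖ ^ 2 := by
    intro l
    refine hB.exists_pos_le_block ⟨_, Finset.mem_Ici.2 le_rfl⟩ ⟨_, Finset.mem_Ici.2 le_rfl⟩ ?_
    simp only [Fin.card_Ici, Fin.val_succ, Fin.val_rev]
    omega
  choose δ hδ hδle using hblock
  obtain ⟨T, hT⟩ := (Set.finite_range fun l => c / δ l).bddAbove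
  refine ⟨((m + 1 : ℕ) : ℝ) * (max 1 T) ^ (m + 1) + 1, fun g h hg hh hle => ?_⟩
  obtain ⟨V, d, hV, hd, hd0, hP⟩ :=
    exists_sorted_diagonalization (Matrix.posSemidef_conjTranspose_mul_self g)
  obtain ⟨W, e, hW, he, he0, hQ⟩ :=
    exists_sorted_diagonalization (Matrix.posSemidef_self_mul_conjTranspose h)
  have hd1 : ∏ i, d i = 1 := by
    apply Complex.ofReal_injective
    rw [← det_eq_prod_of_diagonalization hV hP, Matrix.det_mul, Matrix.det_conjTranspose, hg]
    simp
  have he1 : ∏ i, e i = 1 := by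
    apply Complex.ofReal_injective
    rw [← det_eq_prod_of_diagonalization hW hQ, Matrix.det_mul, Matrix.det_conjTranspose, hh]
    simp
  rw [pencilNormSq_of_diagonalization B hP hQ] at hle
  have hde : ∀ l : Fin m, d l.succ * e l.rev.succ ≤ max 1 T := by
    intro l
    refine le_trans ?_ ((hT ⟨l, rfl⟩).trans (le_max_right _ _))
    rw [le_div_iff₀ (hδ l)]
    calc d l.succ * e l.rev.succ * δ l
        ≤ d l.succ * e l.rev.succ * ∑ i, ∑ j ∈ Finset.Ici l.succ,
            ∑ k ∈ Finset.Ici l.rev.succ, ‖(Vᴴ * B i * W) j k‖ ^ 2 :=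
          mul_le_mul_of_nonneg_left (hδle l V hV W hW) (mul_nonneg (hd0 _) (he0 _))
      _ ≤ ∑ i, ∑ j, ∑ k, d j * e k * ‖(Vᴴ * B i * W) j k‖ ^ 2 := by
          simp only [Finset.mul_sum]
          have hnn : ∀ i j k, 0 ≤ d j * e k * ‖(Vᴴ * B i * W) j k‖ ^ 2 := fun i j k =>
            mul_nonneg (mul_nonneg (hd0 _) (he0 _)) (by positivity)
          refine Finset.sum_le_sum fun i _ => ?_
          refine (Finset.sum_le_sum fun j hj => ?_).trans
            (Finset.sum_le_sum_of_subset_of_nonneg (Finset.subset_univ (Finset.Ici l.succ))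
              fun j _ _ => Finset.sum_nonneg fun k _ => hnn i j k)
          refine (Finset.sum_le_sum fun k hk => ?_).trans
            (Finset.sum_le_sum_of_subset_of_nonneg (Finset.subset_univ (Finset.Ici l.rev.succ))
              fun k _ _ => hnn i j k)
          refine mul_le_mul_of_nonneg_right ?_ (by positivity)
          exact mul_le_mul (hd (Finset.mem_Ici.1 hj)) (he (Finset.mem_Ici.1 hk)) (he0 _) (hd0 _)
      _ ≤ c := hle
  have hed : ∀ l : Fin m, e l.succ * d l.rev.succ ≤ max 1 T := by
    intro l
    have := hde l.rev
    rwa [Fin.rev_rev, mul_comm] at this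
  constructor
  · refine entries_le_of_trace
      (le_pow_of_sorted_products hd he hd0 he0 hd1 he1 (le_max_left _ _) hde) ?_
    exact trace_eq_sum_of_diagonalization hV hP
  · refine entries_le_of_trace
      (le_pow_of_sorted_products he hd he0 hd0 he1 hd1 (le_max_left _ _) hed) ?_
    rw [Matrix.trace_mul_comm]
    exact trace_eq_sum_of_diagonalization hW hQ

lemma PencilUnsplittable.exists_minimizer {m r : ℕ}
    {B : Fin r → Matrix (Fin (m + 1)) (Fin (m + 1)) ℂ} (hB : PencilUnsplittable B) :
    ∃ g h : Matrix (Fin (m + 1)) (Fin (m + 1)) ℂ, g.det = 1 ∧ h.det = 1 ∧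
      ∀ g' h' : Matrix (Fin (m + 1)) (Fin (m + 1)) ℂ, g'.det = 1 → h'.det = 1 →
        pencilNormSq (fun i => g * B i * h) ≤ pencilNormSq (fun i => g' * B i * h') := by
  obtain ⟨F, hFdef⟩ : ∃ F : Matrix (Fin (m + 1)) (Fin (m + 1)) ℂ ×
      Matrix (Fin (m + 1)) (Fin (m + 1)) ℂ → ℝ,
      F = fun p => pencilNormSq fun i => p.1 * B i * p.2 := ⟨_, rfl⟩
  have hFapp : ∀ g h, F (g, h) = pencilNormSq fun i => g * B i * h := fun g h => by rw [hFdef]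
  have hF : Continuous F := by
    rw [hFdef]
    refine continuous_finsetSum _ fun i _ => continuous_finsetSum _ fun j _ =>
      continuous_finsetSum _ fun k _ => ?_
    exact ((((continuous_fst.matrix_mul continuous_const).matrix_mul
      continuous_snd).matrix_elem j k).norm).pow 2
  obtain ⟨R, hR⟩ := hB.exists_bound (F (1, 1))
  let Z : Set (Matrix (Fin (m + 1)) (Fin (m + 1)) ℂ × Matrix (Fin (m + 1)) (Fin (m + 1)) ℂ) :=
    {p | p.1.det = 1} ∩ ({p | p.2.det = 1} ∩ {p | F p ≤ F (1, 1)})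
  have hZ : IsCompact Z := by
    refine ((isCompact_setOf_entries_le R).prod (isCompact_setOf_entries_le R)).of_isClosed_subset
      ?_ fun p hp => hR p.1 p.2 hp.1 hp.2.1 ((hFapp p.1 p.2).symm.trans_le hp.2.2)
    exact (isClosed_eq continuous_fst.matrix_det continuous_const).inter
      ((isClosed_eq continuous_snd.matrix_det continuous_const).inter
        (isClosed_le hF continuous_const))
  obtain ⟨⟨g, h⟩, ⟨hg, hh, hgh⟩, hmin⟩ := hZ.exists_isMinOn
    ⟨(1, 1), Matrix.det_one, Matrix.det_one, le_refl (F (1, 1))⟩ hF.continuousOn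
  refine ⟨g, h, hg, hh, fun g' h' hg' hh' => ?_⟩
  rw [← hFapp, ← hFapp]
  rcases le_total (F (g', h')) (F (1, 1)) with hle | hle
  · have hZ' : (g', h') ∈ Z := ⟨hg', hh', hle⟩
    exact isMinOn_iff.1 hmin _ hZ'
  · exact le_trans hgh hle

lemma eq_smul_one_of_trace_min {n : ℕ} {M : Matrix (Fin n) (Fin n) ℂ} (hM : M.PosSemidef)
    (h : ∀ g : Matrix (Fin n) (Fin n) ℂ, g.det = 1 → M.trace.re ≤ (g * M * gᴴ).trace.re) :
    ∃ c : ℝ, M = (c : ℂ) • (1 : Matrix (Fin n) (Fin n) ℂ) := by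
  obtain ⟨V, d, hV, -, hd0, hP⟩ := exists_sorted_diagonalization hM
  have hV1 : V * Vᴴ = 1 := Matrix.mem_unitaryGroup_iff.1 hV
  have hV2 : Vᴴ * V = 1 := Matrix.mem_unitaryGroup_iff'.1 hV
  have hmin : ∀ a : Fin n → ℝ, ∏ i, a i = 1 → ∑ i, d i ≤ ∑ i, a i ^ 2 * d i := by
    intro a ha
    have h1 := h (V * Matrix.diagonal (fun i => (a i : ℂ)) * Vᴴ) (by
      rw [det_eq_prod_of_diagonalization hV rfl, ha, Complex.ofReal_one])
    have h2 : V * Matrix.diagonal (fun i => (a i : ℂ)) * Vᴴ * M *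
        (V * Matrix.diagonal (fun i => (a i : ℂ)) * Vᴴ)ᴴ =
        V * Matrix.diagonal (fun i => ((a i ^ 2 * d i : ℝ) : ℂ)) * Vᴴ := by
      have h3 : Matrix.diagonal (fun i => ((a i ^ 2 * d i : ℝ) : ℂ)) =
          Matrix.diagonal (fun i => (a i : ℂ)) * Matrix.diagonal (fun i => (d i : ℂ)) *
            Matrix.diagonal (fun i => (a i : ℂ)) := by
        rw [Matrix.diagonal_mul_diagonal, Matrix.diagonal_mul_diagonal]
        congr 1
        funext i
        push_cast
        ring
      have h4 : (Matrix.diagonal (fun i => (a i : ℂ)))ᴴ = Matrix.diagonal (fun i => (a i : ℂ)) := by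
        rw [Matrix.diagonal_conjTranspose]
        congr 1
        funext i
        exact Complex.conj_ofReal _
      have h5 : ∀ X, Vᴴ * (V * X) = X := fun X => by
        rw [← Matrix.mul_assoc, hV2, Matrix.one_mul]
      rw [h3, hP, Matrix.conjTranspose_mul, Matrix.conjTranspose_mul, h4,
        Matrix.conjTranspose_conjTranspose]
      simp only [Matrix.mul_assoc, h5]
    rw [h2, trace_eq_sum_of_diagonalization hV rfl, trace_eq_sum_of_diagonalization hV hP,
      Complex.ofReal_re, Complex.ofReal_re] at h1
    exact h1
  have hconst : ∀ j k, d j = d k := by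
    intro j k
    by_contra hne
    have hjk : j ≠ k := fun hjk => hne (hjk ▸ rfl)
    let s : ℝ := Real.sqrt ((d k + 1) / (d j + 1))
    have hj := hd0 j
    have hk := hd0 k
    have hq : 0 < (d k + 1) / (d j + 1) := by positivity
    have hs : s ^ 2 = (d k + 1) / (d j + 1) := Real.sq_sqrt hq.le
    have hs0 : s ≠ 0 := (Real.sqrt_pos.2 hq).ne'
    let a : Fin n → ℝ := fun i => if i = j then s else if i = k then s⁻¹ else 1
    have haj : a j = s := if_pos rfl
    have hak : a k = s⁻¹ := by simp [a, hjk.symm]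
    have ha : ∏ i, a i = 1 := by
      rw [Finset.prod_eq_mul j k hjk]
      · rw [haj, hak, mul_inv_cancel₀ hs0]
      · intro i _ hi
        simp [a, hi.1, hi.2]
      · simp
      · simp
    have h1 := hmin a ha
    have h2 : ∑ i, (a i ^ 2 * d i - d i) = (s ^ 2 * d j - d j) + ((s⁻¹) ^ 2 * d k - d k) := by
      rw [Finset.sum_eq_add j k hjk]
      · rw [haj, hak]
      · intro i _ hi
        simp [a, hi.1, hi.2]
      · simp
      · simp
    rw [Finset.sum_sub_distrib, inv_pow, hs, inv_div] at h2
    have h3 : (d k + 1) / (d j + 1) * d j - d j + ((d j + 1) / (d k + 1) * d k - d k) =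
        -((d j - d k) ^ 2 / ((d j + 1) * (d k + 1))) := by
      field_simp
      ring
    have h4 : 0 < (d j - d k) ^ 2 / ((d j + 1) * (d k + 1)) := by
      have := sub_ne_zero.2 hne
      positivity
    linarith
  rcases n with _ | n
  · exact ⟨0, Subsingleton.elim _ _⟩
  · refine ⟨d 0, ?_⟩
    have h1 : Matrix.diagonal (fun i => (d i : ℂ)) = (d 0 : ℂ) • (1 : Matrix _ _ ℂ) := by
      rw [Matrix.smul_one_eq_diagonal]
      congr 1
      funext i
      rw [hconst i 0]
    rw [hP, h1, Matrix.mul_smul, Matrix.mul_one, Matrix.smul_mul, hV1]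

/-- An unsplittable pencil can be scaled to a doubly stochastic one. -/
lemma PencilUnsplittable.exists_doublyStochastic {n r : ℕ}
    {B : Fin r → Matrix (Fin n) (Fin n) ℂ} (hB : PencilUnsplittable B) :
    ∃ g h : Matrix (Fin n) (Fin n) ℂ, IsUnit g ∧ IsUnit h ∧
      ∑ i, (g * B i * h) * (g * B i * h)ᴴ = 1 ∧ ∑ i, (g * B i * h)ᴴ * (g * B i * h) = 1 := by
  obtain ⟨i₀, hi₀⟩ := hB.1
  rcases n with _ | n
  · exact absurd (Subsingleton.elim _ _) hi₀
  obtain ⟨g, h, hg, hh, hmin⟩ := hB.exists_minimizer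
  have hgu : IsUnit g := (Matrix.isUnit_iff_isUnit_det g).2 (hg ▸ isUnit_one)
  have hhu : IsUnit h := (Matrix.isUnit_iff_isUnit_det h).2 (hh ▸ isUnit_one)
  obtain ⟨C, hC⟩ : ∃ C : Fin r → Matrix (Fin (n + 1)) (Fin (n + 1)) ℂ, ∀ i, C i = g * B i * h :=
    ⟨_, fun _ => rfl⟩
  have hCmin : ∀ g' h' : Matrix (Fin (n + 1)) (Fin (n + 1)) ℂ, g'.det = 1 → h'.det = 1 →
      pencilNormSq C ≤ pencilNormSq fun i => g' * C i * h' := by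
    intro g' h' hg' hh'
    have h1 := hmin (g' * g) (h * h') (by rw [Matrix.det_mul, hg, hg', one_mul])
      (by rw [Matrix.det_mul, hh, hh', one_mul])
    have h2 : (fun i => g' * g * B i * (h * h')) = fun i => g' * C i * h' := by
      funext i
      rw [hC]
      simp only [Matrix.mul_assoc]
    rwa [h2, ← funext hC] at h1
  obtain ⟨c, hc⟩ : ∃ c : ℝ, ∑ i, C i * (C i)ᴴ = (c : ℂ) • (1 : Matrix _ _ ℂ) := by
    refine eq_smul_one_of_trace_min
      (Matrix.posSemidef_sum _ fun i _ => Matrix.posSemidef_self_mul_conjTranspose (C i))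
      fun g' hg' => ?_
    have h1 : g' * (∑ i, C i * (C i)ᴴ) * g'ᴴ = ∑ i, (g' * C i * 1) * (g' * C i * 1)ᴴ := by
      rw [Finset.mul_sum, Finset.sum_mul]
      simp only [Matrix.mul_one, Matrix.conjTranspose_mul, Matrix.mul_assoc]
    rw [h1, trace_sum_mul_conjTranspose_self,
      trace_sum_mul_conjTranspose_self fun i => g' * C i * 1, Complex.ofReal_re, Complex.ofReal_re]
    exact hCmin g' 1 hg' Matrix.det_one
  obtain ⟨c', hc'⟩ : ∃ c : ℝ, ∑ i, (C i)ᴴ * C i = (c : ℂ) • (1 : Matrix _ _ ℂ) := by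
    refine eq_smul_one_of_trace_min
      (Matrix.posSemidef_sum _ fun i _ => Matrix.posSemidef_conjTranspose_mul_self (C i))
      fun g' hg' => ?_
    have h1 : g' * (∑ i, (C i)ᴴ * C i) * g'ᴴ = ∑ i, (1 * C i * g'ᴴ)ᴴ * (1 * C i * g'ᴴ) := by
      rw [Finset.mul_sum, Finset.sum_mul]
      simp only [Matrix.one_mul, Matrix.conjTranspose_mul, Matrix.conjTranspose_conjTranspose,
        Matrix.mul_assoc]
    rw [h1, trace_sum_conjTranspose_mul_self,
      trace_sum_conjTranspose_mul_self fun i => 1 * C i * g'ᴴ, Complex.ofReal_re, Complex.ofReal_re]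
    refine hCmin 1 g'ᴴ Matrix.det_one ?_
    rw [Matrix.det_conjTranspose, hg', star_one]
  have ht : ((n + 1 : ℕ) : ℝ) * c = pencilNormSq C := by
    apply Complex.ofReal_injective
    rw [← trace_sum_mul_conjTranspose_self, hc, Matrix.trace_smul, Matrix.trace_one,
      Fintype.card_fin]
    push_cast
    rw [smul_eq_mul, mul_comm]
  have ht' : ((n + 1 : ℕ) : ℝ) * c' = pencilNormSq C := by
    apply Complex.ofReal_injective
    rw [← trace_sum_conjTranspose_mul_self, hc', Matrix.trace_smul, Matrix.trace_one,
      Fintype.card_fin]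
    push_cast
    rw [smul_eq_mul, mul_comm]
  have hn : (0 : ℝ) < ((n + 1 : ℕ) : ℝ) := by positivity
  obtain rfl : c' = c := mul_left_cancel₀ hn.ne' (ht'.trans ht.symm)
  have hpos : 0 < c' := by
    have h0 : 0 ≤ pencilNormSq C := by
      unfold pencilNormSq
      positivity
    refine pos_of_mul_pos_right (ht ▸ lt_of_le_of_ne h0 fun h1 => hi₀ ?_) hn.le
    have h2 := eq_zero_of_pencilNormSq_eq_zero h1.symm i₀
    rwa [hC, hhu.mul_left_eq_zero, hgu.mul_right_eq_zero] at h2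
  let s : ℝ := (Real.sqrt c')⁻¹
  have hs : s ≠ 0 := (inv_pos.2 (Real.sqrt_pos.2 hpos)).ne'
  have hsc : (s : ℂ) * ((s : ℂ) * (c' : ℂ)) = 1 := by
    have : s * (s * c') = 1 := by
      rw [← mul_assoc, ← sq, inv_pow, Real.sq_sqrt hpos.le, inv_mul_cancel₀ hpos.ne']
    exact_mod_cast this
  have hstar : star (s : ℂ) = s := Complex.conj_ofReal s
  refine ⟨(s : ℂ) • g, h, ?_, hhu, ?_, ?_⟩
  · rw [Matrix.isUnit_iff_isUnit_det, Matrix.det_smul, hg, mul_one]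
    exact (pow_ne_zero _ (Complex.ofReal_ne_zero.2 hs)).isUnit
  · simp only [Matrix.conjTranspose_smul, hstar, Matrix.smul_mul, Matrix.mul_smul, ← hC]
    rw [← Finset.smul_sum, ← Finset.smul_sum, hc, smul_smul, smul_smul, mul_assoc, hsc, one_smul]
  · simp only [Matrix.conjTranspose_smul, hstar, Matrix.smul_mul, Matrix.mul_smul, ← hC]
    rw [← Finset.smul_sum, ← Finset.smul_sum, hc', smul_smul, smul_smul, mul_assoc, hsc, one_smul]

lemma PencilLRSemisimple.exists_doublyStochastic {n r : ℕ}
    {A : Fin r → Matrix (Fin n) (Fin n) ℂ} (hA : PencilLRSemisimple A) :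
    ∃ g h : Matrix (Fin n) (Fin n) ℂ, IsUnit g ∧ IsUnit h ∧
      ∑ i, (g * A i * h) * (g * A i * h)ᴴ = 1 ∧ ∑ i, (g * A i * h)ᴴ * (g * A i * h) = 1 := by
  obtain ⟨L, R, hL, hR, k, d, B, e, hLR, hB⟩ := hA
  choose g h hg hh h1 h2 using fun j => (hB j).exists_doublyStochastic
  have hunit : ∀ {f : (j : Fin k) → Matrix (Fin (d j)) (Fin (d j)) ℂ}, (∀ j, IsUnit (f j)) →
      IsUnit ((Matrix.blockDiagonal' f).submatrix e e) := by
    intro f hf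
    rw [Matrix.isUnit_submatrix_equiv]
    exact (Pi.isUnit_iff.2 hf).map (Matrix.blockDiagonal'RingHom (fun j => Fin (d j)) ℂ)
  have hsum : ∀ f : Fin r → (j : Fin k) → Matrix (Fin (d j)) (Fin (d j)) ℂ,
      (∀ j, ∑ i, f i j = 1) → ∑ i, (Matrix.blockDiagonal' (f i)).submatrix e e = 1 := by
    intro f hf
    have h3 : ∑ i, Matrix.blockDiagonal' (f i) = 1 := by
      have h4 := map_sum (Matrix.blockDiagonal'RingHom (fun j => Fin (d j)) ℂ) f Finset.univ
      have h5 : ∑ i, f i = 1 := by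
        funext j
        rw [Finset.sum_apply, hf]
        rfl
      rw [h5, map_one] at h4
      exact h4.symm
    ext a b
    rw [Matrix.sum_apply]
    simp only [Matrix.submatrix_apply]
    rw [← Matrix.sum_apply, h3, ← Matrix.submatrix_apply (1 : Matrix _ _ ℂ) e e,
      Matrix.submatrix_one_equiv]
  have hM : ∀ i, (Matrix.blockDiagonal' g).submatrix e e * L * A i *
      (R * (Matrix.blockDiagonal' h).submatrix e e) =
      (Matrix.blockDiagonal' fun j => g j * B j i * h j).submatrix e e := by
    intro i
    have h3 : (Matrix.blockDiagonal' g).submatrix e e * L * A i *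
        (R * (Matrix.blockDiagonal' h).submatrix e e) =
        (Matrix.blockDiagonal' g).submatrix e e * (L * A i * R) *
          (Matrix.blockDiagonal' h).submatrix e e := by
      simp only [Matrix.mul_assoc]
    rw [h3, hLR, Matrix.submatrix_mul_equiv, Matrix.submatrix_mul_equiv,
      ← Matrix.blockDiagonal'_mul, ← Matrix.blockDiagonal'_mul]
  refine ⟨(Matrix.blockDiagonal' g).submatrix e e * L,
    R * (Matrix.blockDiagonal' h).submatrix e e, (hunit hg).mul hL, hR.mul (hunit hh), ?_, ?_⟩
  · simp only [hM, Matrix.conjTranspose_submatrix, Matrix.blockDiagonal'_conjTranspose,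
      Matrix.submatrix_mul_equiv, ← Matrix.blockDiagonal'_mul]
    exact hsum _ h1
  · simp only [hM, Matrix.conjTranspose_submatrix, Matrix.blockDiagonal'_conjTranspose,
      Matrix.submatrix_mul_equiv, ← Matrix.blockDiagonal'_mul]
    exact hsum _ h2

lemma PencilLRSemisimple.exists_symmetric_scaling {n r : ℕ}
    {A : Fin r → Matrix (Fin n) (Fin n) ℂ} (hA : ∀ i, (A i).IsHermitian)
    (h : PencilLRSemisimple A) :
    ∃ C : Matrix (Fin n) (Fin n) ℂ, C.PosDef ∧ ∑ i, A i * C * A i = C⁻¹ := by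
  obtain ⟨L, R, hL, hR, h1, h2⟩ := h.exists_doublyStochastic
  have hX : (R * Rᴴ).PosDef := by
    simpa using Matrix.PosDef.one.mul_mul_conjTranspose_same
      (Matrix.vecMul_injective_iff_isUnit.2 hR)
  have hY : (Lᴴ * L).PosDef := by
    simpa using Matrix.PosDef.one.conjTranspose_mul_mul_same
      (Matrix.mulVec_injective_iff_isUnit.2 hL)
  refine _root_.exists_symmetric_scaling hA hX hY ?_ ?_
  · refine (Matrix.inv_eq_left_inv ?_).symm
    rw [← Matrix.mul_assoc, mul_eq_one_comm, ← h1, Finset.sum_mul, Finset.mul_sum]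
    refine Finset.sum_congr rfl fun i _ => ?_
    simp only [Matrix.conjTranspose_mul, (hA i).eq, Matrix.mul_assoc]
  · refine (Matrix.inv_eq_right_inv ?_).symm
    rw [Matrix.mul_assoc, mul_eq_one_comm, ← h2, Finset.mul_sum, Finset.sum_mul]
    refine Finset.sum_congr rfl fun i _ => ?_
    simp only [Matrix.conjTranspose_mul, (hA i).eq, Matrix.mul_assoc]

/-- For a Hermitian pencil `(A₁, …, A_r)` with covariance map
`η(X) = ∑ᵢ Aᵢ X Aᵢ`: the pencil is LR-semisimple iff `η` is symmetrically DS-scalable,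
i.e. there is a positive definite `C` with `η(C) = C⁻¹`. -/
theorem lr_semisimple_iff_symmetrically_ds_scalable {n r : ℕ}
    (A : Fin r → Matrix (Fin n) (Fin n) ℂ) (hA : ∀ i, (A i).IsHermitian) :
    PencilLRSemisimple A ↔
      ∃ C : Matrix (Fin n) (Fin n) ℂ, C.PosDef ∧ ∑ i, A i * C * A i = C⁻¹ := by
  exact ⟨fun h => h.exists_symmetric_scaling hA,
    fun ⟨_, hC, h⟩ => lrSemisimple_of_symmetric_scaling hA hC h⟩
end

section
/- Let A_1,…,A_r ∈ M_n(ℂ) and let η(X) = ∑_{i=1}^r A_i X A_iᴴ be the associated completely positive map, where ᴴ denotes conjugate transpose. Then the matrix pencil (A_1,…,A_r) is full if and only if η is rank non-decreasing, i.e., rank(η(B)) ≥ rank(B) for every positive semidefinite matrix B ∈ M_n(ℂ). -/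
open Matrix
open scoped ComplexOrder

/-- A matrix pencil is *full* if there are no subspaces `R, L ⊆ ℂⁿ` with `Aᵢ(R) ⊆ L` for all
`i` and `dim R > dim L`. -/
def PencilFull {n r : ℕ} (A : Fin r → Matrix (Fin n) (Fin n) ℂ) : Prop :=
  ¬ ∃ (R L : Submodule ℂ (Fin n → ℂ)),
      (∀ i, Submodule.map ((A i).mulVecLin) R ≤ L) ∧
      Module.finrank ℂ L < Module.finrank ℂ R

open scoped MatrixOrder in
theorem Matrix.PosSemidef.exists_eq_mul_conjTranspose {n : Type*} [Fintype n]
    {B : Matrix n n ℂ} (hB : B.PosSemidef) : ∃ C : Matrix n n ℂ, B = C * Cᴴ := by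
  classical
  exact CStarAlgebra.nonneg_iff_eq_mul_star_self.mp hB.nonneg

theorem Matrix.range_mulVecLin_self_mul_conjTranspose {m n : Type*} [Fintype m] [Fintype n]
    (K : Matrix m n ℂ) :
    LinearMap.range (K * Kᴴ).mulVecLin = LinearMap.range K.mulVecLin := by
  refine Submodule.eq_of_le_of_finrank_eq ?_ (Matrix.rank_self_mul_conjTranspose K)
  rw [Matrix.mulVecLin_mul]
  exact LinearMap.range_comp_le_range _ _

/-- The range of `∑ᵢ Aᵢ (C Cᴴ) Aᵢᴴ` contains the range of each `Aᵢ C`. -/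
theorem Matrix.range_mul_le_range_sum {ι m n k : Type*} [Fintype ι] [Fintype m] [Fintype n]
    [Fintype k] (A : ι → Matrix m n ℂ) (C : Matrix n k ℂ) (i : ι) :
    LinearMap.range (A i * C).mulVecLin ≤
      LinearMap.range (∑ i, A i * (C * Cᴴ) * (A i)ᴴ).mulVecLin := by
  classical
  let K : Matrix m (ι × k) ℂ := Matrix.of fun p q => (A q.1 * C) p q.2
  have hK : ∑ i, A i * (C * Cᴴ) * (A i)ᴴ = K * Kᴴ := by
    have h : ∀ i, A i * (C * Cᴴ) * (A i)ᴴ = (A i * C) * (A i * C)ᴴ := fun i => by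
      simp only [Matrix.conjTranspose_mul, Matrix.mul_assoc]
    ext p q
    simp only [h, Matrix.sum_apply]
    simp only [Matrix.mul_apply (M := K), Matrix.mul_apply (N := (A _ * C)ᴴ),
      Fintype.sum_prod_type, K, Matrix.conjTranspose_apply, Matrix.of_apply]
  rw [hK, Matrix.range_mulVecLin_self_mul_conjTranspose, Matrix.range_mulVecLin,
    Matrix.range_mulVecLin]
  refine Submodule.span_mono ?_
  rintro _ ⟨j, rfl⟩
  exact ⟨(i, j), rfl⟩

/-- Every subspace of `ℂⁿ` is the range of a positive semidefinite matrix. -/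
theorem Matrix.exists_posSemidef_range_eq {n : Type*} [Fintype n]
    (R : Submodule ℂ (n → ℂ)) :
    ∃ B : Matrix n n ℂ, B.PosSemidef ∧ LinearMap.range B.mulVecLin = R := by
  classical
  obtain ⟨S, hS⟩ := R.exists_isCompl
  let C := LinearMap.toMatrix' (R.subtype ∘ₗ R.projectionOnto S hS)
  refine ⟨C * Cᴴ, Matrix.posSemidef_self_mul_conjTranspose C, ?_⟩
  rw [Matrix.range_mulVecLin_self_mul_conjTranspose, ← Matrix.toLin'_apply',
    Matrix.toLin'_toMatrix', LinearMap.range_comp]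
  simp

/-- A pencil `(A₁, …, A_r)` is full iff the completely positive map
`η(X) = ∑ᵢ Aᵢ X Aᵢᴴ` is rank non-decreasing. -/
theorem full_iff_rank_nondecreasing {n r : ℕ}
    (A : Fin r → Matrix (Fin n) (Fin n) ℂ) :
    PencilFull A ↔
      ∀ B : Matrix (Fin n) (Fin n) ℂ, B.PosSemidef →
        B.rank ≤ (∑ i, A i * B * (A i)ᴴ).rank := by
  constructor
  · intro hA B hB
    obtain ⟨C, rfl⟩ := hB.exists_eq_mul_conjTranspose
    by_contra! h
    refine hA ⟨LinearMap.range (C * Cᴴ).mulVecLin, _, fun i => ?_, h⟩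
    rw [Matrix.range_mulVecLin_self_mul_conjTranspose, ← LinearMap.range_comp,
      ← Matrix.mulVecLin_mul]
    exact Matrix.range_mul_le_range_sum A C i
  · rintro h ⟨R, L, hRL, hlt⟩
    obtain ⟨B, hB, rfl⟩ := Matrix.exists_posSemidef_range_eq R
    refine absurd (h B hB) (not_le.mpr (lt_of_le_of_lt (Submodule.finrank_mono ?_) hlt))
    rintro _ ⟨v, rfl⟩
    rw [Matrix.mulVecLin_apply, Matrix.sum_mulVec]
    refine Submodule.sum_mem _ fun i _ => hRL i ⟨B *ᵥ ((A i)ᴴ *ᵥ v), ⟨_, rfl⟩, ?_⟩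
    simp only [Matrix.mulVecLin_apply, Matrix.mulVec_mulVec, Matrix.mul_assoc]
end

section
/- Let A_1,…,A_r ∈ M_n(ℂ) and suppose there exist invertible matrices c_1, c_2 ∈ GL_n(ℂ) such that the scaled completely positive map X ↦ c_1 (∑_{i=1}^r A_i (c_2ᴴ X c_2) A_iᴴ) c_1ᴴ is doubly stochastic. Then the matrix pencil (A_1,…,A_r) is LR-semisimple. -/
open Matrix
open scoped ComplexOrder

theorem submatrix_mul_submatrix_id {l l' m o o' α : Type*} [Fintype m]
    [NonUnitalNonAssocSemiring α] (M : Matrix l m α) (N : Matrix m o α) (f : l' → l)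
    (g : o' → o) : M.submatrix f id * N.submatrix id g = (M * N).submatrix f g :=
  rfl

/-- Every subspace of `ℂⁿ` of dimension `s` is spanned by the first `s` columns of a
unitary matrix. -/
theorem exists_unitary_adapted {n s t : ℕ} (hst : s + t = n) (R : Submodule ℂ (Fin n → ℂ))
    (hR : Module.finrank ℂ R = s) :
    ∃ U : Matrix (Fin n) (Fin s ⊕ Fin t) ℂ, Uᴴ * U = 1 ∧ U * Uᴴ = 1 ∧
      (∀ i, U.col (Sum.inl i) ∈ R) ∧ ∀ j, ∀ v ∈ R, (Uᴴ *ᵥ v) (Sum.inr j) = 0 := by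
  let φ : EuclideanSpace ℂ (Fin n) ≃ₗ[ℂ] (Fin n → ℂ) := WithLp.linearEquiv 2 ℂ (Fin n → ℂ)
  let R' : Submodule ℂ (EuclideanSpace ℂ (Fin n)) := R.map (φ.symm : (Fin n → ℂ) →ₗ[ℂ] _)
  have hR' : Module.finrank ℂ R' = s := by
    rw [← hR]; exact LinearEquiv.finrank_map_eq φ.symm R
  let c : OrthonormalBasis (Fin s) ℂ R' := (stdOrthonormalBasis ℂ R').reindex (finCongr hR')
  let v : Fin s ⊕ Fin t → EuclideanSpace ℂ (Fin n) := Sum.elim (fun i => (c i : _)) 0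
  have hv : Orthonormal ℂ ((Set.range Sum.inl).domRestrict v) := by
    have hc : Orthonormal ℂ (fun i => (c i : EuclideanSpace ℂ (Fin n))) :=
      c.orthonormal.comp_linearIsometry R'.subtypeₗᵢ
    rw [orthonormal_iff_ite] at hc ⊢
    rintro ⟨_, i, rfl⟩ ⟨_, j, rfl⟩
    exact (hc i j).trans (if_congr ⟨fun h => by subst h; rfl,
      fun h => Sum.inl_injective (congrArg Subtype.val h)⟩ rfl rfl)
  obtain ⟨b, hb⟩ := hv.exists_orthonormalBasis_extension_of_card_eq
    (by simp [hst])
  have hbc : ∀ i, b (Sum.inl i) = c i := fun i => hb _ ⟨i, rfl⟩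
  let U : Matrix (Fin n) (Fin s ⊕ Fin t) ℂ := Matrix.of fun x i => b i x
  have hmul : ∀ (i) (x : EuclideanSpace ℂ (Fin n)), (Uᴴ *ᵥ x.ofLp) i = inner ℂ (b i) x := by
    intro i x
    rw [EuclideanSpace.inner_eq_star_dotProduct, dotProduct_comm]
    rfl
  have hU : Uᴴ * U = 1 := by
    ext i j
    have := hmul i (b j)
    rw [orthonormal_iff_ite.1 b.orthonormal i j] at this
    rw [Matrix.one_apply, ← this]
    rfl
  refine ⟨U, hU, (Matrix.mul_eq_one_comm_of_card_eq _ _ _ (by simp [hst])).1 hU, fun i => ?_,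
    fun j x hx => ?_⟩
  · obtain ⟨y, hy, hyc⟩ := (c i).2
    have : U.col (Sum.inl i) = y := by
      have h : U.col (Sum.inl i) = φ (b (Sum.inl i)) := rfl
      rw [h, hbc, ← hyc]
      exact φ.apply_symm_apply y
    rwa [this]
  · have hx' : φ.symm x ∈ R' := ⟨x, hx, rfl⟩
    refine (hmul (Sum.inr j) (φ.symm x)).trans ?_
    have hsum := congrArg (Subtype.val) (c.sum_repr ⟨φ.symm x, hx'⟩)
    simp only [Submodule.coe_sum, Submodule.coe_smul] at hsum
    rw [← hsum, inner_sum]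
    refine Finset.sum_eq_zero fun i _ => ?_
    rw [inner_smul_right, ← hbc, orthonormal_iff_ite.1 b.orthonormal]
    simp

/-- The Kraus operators `K i` define a doubly stochastic map. -/
def IsDoublyStochasticPencil {ι : Type*} [Fintype ι] [DecidableEq ι] {r : ℕ}
    (K : Fin r → Matrix ι ι ℂ) : Prop :=
  ∑ i, K i * (K i)ᴴ = 1 ∧ ∑ i, (K i)ᴴ * K i = 1

/-- A pencil that multiplication by unitary matrices on the left and on the right makes block
diagonal with unsplittable blocks. -/
def IsUnitarilySemisimple {ι : Type*} [Fintype ι] [DecidableEq ι] {r : ℕ}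
    (K : Fin r → Matrix ι ι ℂ) : Prop :=
  ∃ (J : Type) (_ : Fintype J) (_ : DecidableEq J) (d : J → ℕ)
    (B : (j : J) → Fin r → Matrix (Fin (d j)) (Fin (d j)) ℂ)
    (L : Matrix (Σ j, Fin (d j)) ι ℂ) (R : Matrix ι (Σ j, Fin (d j)) ℂ),
    L * Lᴴ = 1 ∧ Lᴴ * L = 1 ∧ R * Rᴴ = 1 ∧ Rᴴ * R = 1 ∧
    (∀ i, L * K i * R = Matrix.blockDiagonal' fun j => B j i) ∧
    ∀ j, PencilUnsplittable (B j)

section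

variable {ι κ : Type*} [Fintype ι] [DecidableEq ι] [Fintype κ] [DecidableEq κ] {r : ℕ}

theorem IsDoublyStochasticPencil.unitary_mul {K : Fin r → Matrix ι ι ℂ}
    (h : IsDoublyStochasticPencil K) {V U : Matrix ι κ ℂ} (hV : Vᴴ * V = 1) (hV' : V * Vᴴ = 1)
    (hU : Uᴴ * U = 1) (hU' : U * Uᴴ = 1) :
    IsDoublyStochasticPencil fun i => Vᴴ * K i * U := by
  constructor
  · have : ∀ i, Vᴴ * K i * U * (Vᴴ * K i * U)ᴴ = Vᴴ * (K i * (K i)ᴴ) * V := fun i => by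
      calc _ = Vᴴ * K i * (U * Uᴴ) * (K i)ᴴ * V := by
            simp only [conjTranspose_mul, conjTranspose_conjTranspose, Matrix.mul_assoc]
        _ = _ := by rw [hU', Matrix.mul_one]; simp only [Matrix.mul_assoc]
    simp only [this]
    rw [← Matrix.sum_mul, ← Matrix.mul_sum, h.1, Matrix.mul_one, hV]
  · have : ∀ i, (Vᴴ * K i * U)ᴴ * (Vᴴ * K i * U) = Uᴴ * ((K i)ᴴ * K i) * U := fun i => by
      calc _ = Uᴴ * (K i)ᴴ * (V * Vᴴ) * K i * U := by
            simp only [conjTranspose_mul, conjTranspose_conjTranspose, Matrix.mul_assoc]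
        _ = _ := by rw [hV', Matrix.mul_one]; simp only [Matrix.mul_assoc]
    simp only [this]
    rw [← Matrix.sum_mul, ← Matrix.mul_sum, h.2, Matrix.mul_one, hU]

theorem IsUnitarilySemisimple.of_unitary_mul {K : Fin r → Matrix ι ι ℂ} {V U : Matrix ι κ ℂ}
    (hV : Vᴴ * V = 1) (hV' : V * Vᴴ = 1) (hU : Uᴴ * U = 1) (hU' : U * Uᴴ = 1)
    (h : IsUnitarilySemisimple fun i => Vᴴ * K i * U) : IsUnitarilySemisimple K := by
  obtain ⟨J, _, _, d, B, L, R, hL, hL', hR, hR', hB, hB'⟩ := h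
  refine ⟨J, inferInstance, inferInstance, d, B, L * Vᴴ, U * R, ?_, ?_, ?_, ?_, fun i => ?_, hB'⟩
  · calc _ = L * (Vᴴ * V) * Lᴴ := by
          simp only [conjTranspose_mul, conjTranspose_conjTranspose, Matrix.mul_assoc]
      _ = 1 := by rw [hV, Matrix.mul_one, hL]
  · calc _ = V * (Lᴴ * L) * Vᴴ := by
          simp only [conjTranspose_mul, conjTranspose_conjTranspose, Matrix.mul_assoc]
      _ = 1 := by rw [hL', Matrix.mul_one, hV']
  · calc _ = U * (R * Rᴴ) * Uᴴ := by
          simp only [conjTranspose_mul, Matrix.mul_assoc]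
      _ = 1 := by rw [hR, Matrix.mul_one, hU']
  · calc _ = Rᴴ * (Uᴴ * U) * R := by
          simp only [conjTranspose_mul, Matrix.mul_assoc]
      _ = 1 := by rw [hU, Matrix.mul_one, hR']
  · rw [← hB i]
    simp only [Matrix.mul_assoc]

/-- An upper block triangular doubly stochastic pencil is block diagonal, and its diagonal
blocks are doubly stochastic. -/
theorem IsDoublyStochasticPencil.of_fromBlocks {B : Fin r → Matrix ι ι ℂ}
    {C : Fin r → Matrix ι κ ℂ} {D : Fin r → Matrix κ κ ℂ}
    (h : IsDoublyStochasticPencil fun i => fromBlocks (B i) (C i) 0 (D i)) :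
    (∀ i, C i = 0) ∧ IsDoublyStochasticPencil B ∧ IsDoublyStochasticPencil D := by
  obtain ⟨h₁, h₂⟩ := h
  simp only [fromBlocks_conjTranspose, fromBlocks_multiply] at h₁ h₂
  have e₁ : ∑ i, (B i * (B i)ᴴ + C i * (C i)ᴴ) = 1 := by
    ext x y
    simpa [Matrix.sum_apply, Matrix.one_apply] using congrFun₂ h₁ (Sum.inl x) (Sum.inl y)
  have e₂ : ∑ i, D i * (D i)ᴴ = 1 := by
    ext x y
    simpa [Matrix.sum_apply, Matrix.one_apply] using congrFun₂ h₁ (Sum.inr x) (Sum.inr y)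
  have e₃ : ∑ i, (B i)ᴴ * B i = 1 := by
    ext x y
    simpa [Matrix.sum_apply, Matrix.one_apply] using congrFun₂ h₂ (Sum.inl x) (Sum.inl y)
  have e₄ : ∑ i, ((C i)ᴴ * C i + (D i)ᴴ * D i) = 1 := by
    ext x y
    simpa [Matrix.sum_apply, Matrix.one_apply] using congrFun₂ h₂ (Sum.inr x) (Sum.inr y)
  have htr : ∑ i, (C i * (C i)ᴴ).trace = 0 := by
    have t₁ := congrArg trace e₁
    have t₃ := congrArg trace e₃
    simp only [trace_sum, trace_add, Finset.sum_add_distrib] at t₁ t₃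
    simp only [fun i => trace_mul_comm (B i)ᴴ (B i)] at t₃
    rw [t₃] at t₁
    simpa using t₁
  have hC : ∀ i, C i = 0 := fun i => by
    rw [Finset.sum_eq_zero_iff_of_nonneg
      fun i _ => (posSemidef_self_mul_conjTranspose (C i)).trace_nonneg] at htr
    exact trace_mul_conjTranspose_self_eq_zero_iff.1 (htr i (Finset.mem_univ i))
  refine ⟨hC, ⟨?_, e₃⟩, e₂, ?_⟩
  · simpa [hC] using e₁
  · simpa [hC] using e₄

theorem IsUnitarilySemisimple.fromBlocks {B : Fin r → Matrix ι ι ℂ} {D : Fin r → Matrix κ κ ℂ}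
    (hB : IsUnitarilySemisimple B) (hD : IsUnitarilySemisimple D) :
    IsUnitarilySemisimple fun i => fromBlocks (B i) 0 0 (D i) := by
  obtain ⟨J₁, _, _, d₁, B₁, L₁, R₁, hL₁, hL₁', hR₁, hR₁', h₁, hu₁⟩ := hB
  obtain ⟨J₂, _, _, d₂, B₂, L₂, R₂, hL₂, hL₂', hR₂, hR₂', h₂, hu₂⟩ := hD
  let d : J₁ ⊕ J₂ → ℕ := Sum.elim d₁ d₂
  let B' : (j : J₁ ⊕ J₂) → Fin r → Matrix (Fin (d j)) (Fin (d j)) ℂ := fun j =>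
    match j with
    | Sum.inl j => B₁ j
    | Sum.inr j => B₂ j
  let f : (Σ j, Fin (d j)) ≃ (Σ j, Fin (d₁ j)) ⊕ (Σ j, Fin (d₂ j)) :=
    Equiv.sumSigmaDistrib fun j => Fin (d j)
  refine ⟨J₁ ⊕ J₂, inferInstance, inferInstance, d, B',
    (Matrix.fromBlocks L₁ 0 0 L₂).submatrix f id, (Matrix.fromBlocks R₁ 0 0 R₂).submatrix id f,
    ?_, ?_, ?_, ?_, fun i => ?_, ?_⟩
  · rw [conjTranspose_submatrix, submatrix_mul_submatrix_id,
      fromBlocks_conjTranspose, fromBlocks_multiply]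
    simp [hL₁, hL₂]
  · rw [conjTranspose_submatrix, submatrix_mul_equiv,
      fromBlocks_conjTranspose, fromBlocks_multiply]
    simp [hL₁', hL₂']
  · rw [conjTranspose_submatrix, submatrix_mul_equiv,
      fromBlocks_conjTranspose, fromBlocks_multiply]
    simp [hR₁, hR₂]
  · rw [conjTranspose_submatrix, submatrix_mul_submatrix_id,
      fromBlocks_conjTranspose, fromBlocks_multiply]
    simp [hR₁', hR₂']
  · have : (Matrix.fromBlocks L₁ 0 0 L₂).submatrix f id * Matrix.fromBlocks (B i) 0 0 (D i) *
        (Matrix.fromBlocks R₁ 0 0 R₂).submatrix id f =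
        (Matrix.fromBlocks (L₁ * B i * R₁) 0 0 (L₂ * D i * R₂)).submatrix f f := by
      have hm : Matrix.fromBlocks L₁ 0 0 L₂ * Matrix.fromBlocks (B i) 0 0 (D i) *
          Matrix.fromBlocks R₁ 0 0 R₂ =
          Matrix.fromBlocks (L₁ * B i * R₁) 0 0 (L₂ * D i * R₂) := by
        simp [fromBlocks_multiply]
      rw [← hm]
      rfl
    rw [this, h₁, h₂]
    ext ⟨x | x, a⟩ ⟨y | y, b⟩
    · by_cases hxy : x = y
      · subst hxy
        exact (blockDiagonal'_apply_eq (fun j => B₁ j i) x a b).trans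
          (blockDiagonal'_apply_eq (fun j => B' j i) _ a b).symm
      · exact (blockDiagonal'_apply_ne (fun j => B₁ j i) a b hxy).trans
          (blockDiagonal'_apply_ne (fun j => B' j i) a b (by simpa using hxy)).symm
    · exact (blockDiagonal'_apply_ne _ _ _ Sum.inl_ne_inr).symm
    · exact (blockDiagonal'_apply_ne _ _ _ Sum.inr_ne_inl).symm
    · by_cases hxy : x = y
      · subst hxy
        exact (blockDiagonal'_apply_eq (fun j => B₂ j i) x a b).trans
          (blockDiagonal'_apply_eq (fun j => B' j i) _ a b).symm
      · exact (blockDiagonal'_apply_ne (fun j => B₂ j i) a b hxy).trans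
          (blockDiagonal'_apply_ne (fun j => B' j i) a b (by simpa using hxy)).symm
  · rintro (j | j)
    · exact hu₁ j
    · exact hu₂ j

theorem IsUnitarilySemisimple.of_unsplittable {n : ℕ} {K : Fin r → Matrix (Fin n) (Fin n) ℂ}
    (h : PencilUnsplittable K) : IsUnitarilySemisimple K := by
  let f : (Σ _ : Unit, Fin n) ≃ Fin n := Equiv.uniqueSigma fun _ => Fin n
  refine ⟨Unit, inferInstance, inferInstance, fun _ => n, fun _ => K,
    (1 : Matrix (Fin n) (Fin n) ℂ).submatrix f id, (1 : Matrix (Fin n) (Fin n) ℂ).submatrix id f,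
    ?_, ?_, ?_, ?_, fun i => ?_, fun _ => h⟩
  · rw [conjTranspose_submatrix, submatrix_mul_submatrix_id]
    simp
  · rw [conjTranspose_submatrix, submatrix_mul_equiv]
    simp
  · rw [conjTranspose_submatrix, submatrix_mul_equiv]
    simp
  · rw [conjTranspose_submatrix, submatrix_mul_submatrix_id]
    simp
  · ext ⟨x, a⟩ ⟨y, b⟩
    simp only [Matrix.mul_apply, submatrix_apply, id,
      Matrix.one_apply, mul_ite, mul_one, mul_zero, ite_mul, one_mul, zero_mul,
      Finset.sum_ite_eq, Finset.sum_ite_eq', Finset.mem_univ, if_true]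
    exact (blockDiagonal'_apply_eq (fun _ : Unit => K i) x a b).symm

theorem IsUnitarilySemisimple.of_isEmpty [IsEmpty ι] (K : Fin r → Matrix ι ι ℂ) :
    IsUnitarilySemisimple K :=
  ⟨Empty, inferInstance, inferInstance, fun _ => 0, fun _ _ => 0, 0, 0, Subsingleton.elim _ _,
    Subsingleton.elim _ _, Subsingleton.elim _ _, Subsingleton.elim _ _,
    fun _ => Subsingleton.elim _ _, fun j => j.elim⟩

theorem IsDoublyStochasticPencil.isUnitarilySemisimple {n : ℕ}
    {K : Fin r → Matrix (Fin n) (Fin n) ℂ} (hK : IsDoublyStochasticPencil K) :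
    IsUnitarilySemisimple K := by
  induction n using Nat.strong_induction_on with
  | _ n ih =>
  rcases Nat.eq_zero_or_pos n with rfl | hn
  · exact .of_isEmpty K
  by_cases hs : PencilSplittable K
  · obtain ⟨R, L, h1, h2, h3, hRL⟩ := hs
    obtain ⟨s, hs⟩ : ∃ s, Module.finrank ℂ R = s := ⟨_, rfl⟩
    have hst : s + (n - s) = n := by omega
    obtain ⟨U, hU, hU', hUR, -⟩ := exists_unitary_adapted hst R hs
    obtain ⟨V, hV, hV', -, hVL⟩ := exists_unitary_adapted hst L (h3 ▸ hs)
    have hM := hK.unitary_mul hV hV' hU hU'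
    have h21 : ∀ i, (Vᴴ * K i * U).toBlocks₂₁ = 0 := fun i => by
      ext x y
      rw [Matrix.mul_assoc]
      exact hVL x _ (hRL i ⟨_, hUR y, rfl⟩)
    have hblock : ∀ i, Vᴴ * K i * U = Matrix.fromBlocks (Vᴴ * K i * U).toBlocks₁₁
        (Vᴴ * K i * U).toBlocks₁₂ 0 (Vᴴ * K i * U).toBlocks₂₂ := fun i => by
      rw [← h21 i, fromBlocks_toBlocks]
    rw [funext hblock] at hM
    obtain ⟨hC, hB, hD⟩ := hM.of_fromBlocks
    refine .of_unitary_mul hV hV' hU hU' ?_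
    rw [funext hblock]
    simp only [hC]
    exact .fromBlocks (ih s (by omega) hB) (ih (n - s) (by omega) hD)
  · refine .of_unsplittable ⟨?_, hs⟩
    by_contra! h0
    have : NeZero n := ⟨hn.ne'⟩
    simpa [h0] using hK.1

theorem IsUnitarilySemisimple.pencilLRSemisimple {n : ℕ} {A : Fin r → Matrix (Fin n) (Fin n) ℂ}
    {c₁ c₂ : Matrix (Fin n) (Fin n) ℂ} (hc₁ : IsUnit c₁) (hc₂ : IsUnit c₂)
    (h : IsUnitarilySemisimple fun i => c₁ * A i * c₂) : PencilLRSemisimple A := by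
  obtain ⟨J, _, _, d, B, L, R, hL, hL', hR, hR', hB, hu⟩ := h
  let g : Fin (Fintype.card J) ≃ J := (Fintype.equivFin J).symm
  let f : (Σ k, Fin (d (g k))) ≃ Σ j, Fin (d j) :=
    Equiv.sigmaCongrLeft (β := fun j => Fin (d j)) g
  have hcard : Fintype.card (Fin n) = Fintype.card (Σ k, Fin (d (g k))) := by
    rw [Fintype.card_congr f]
    exact square_of_invertible Lᴴ L hL' hL
  let e : Fin n ≃ Σ k, Fin (d (g k)) := Fintype.equivOfCardEq hcard
  let p : Fin n ≃ Σ j, Fin (d j) := e.trans f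
  have hLu : IsUnit (L.submatrix p id) := by
    refine IsUnit.of_mul_eq_one (Lᴴ.submatrix id p) ?_
    rw [submatrix_mul_submatrix_id, hL]
    simp
  have hRu : IsUnit (R.submatrix id p) := by
    refine IsUnit.of_mul_eq_one (Rᴴ.submatrix p id) ?_
    rw [submatrix_mul_equiv, hR]
    simp
  refine ⟨L.submatrix p id * c₁, c₂ * R.submatrix id p, hLu.mul hc₁, hc₂.mul hRu,
    Fintype.card J, fun k => d (g k), fun k => B (g k), e, fun i => ?_, fun k => hu (g k)⟩
  have h1 : L.submatrix p id * c₁ * A i * (c₂ * R.submatrix id p) =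
      (L * (c₁ * A i * c₂) * R).submatrix p p := by
    simp only [← Matrix.mul_assoc]
    rfl
  rw [h1, hB]
  ext x y
  simp only [submatrix_apply, p, Equiv.trans_apply]
  rcases e x with ⟨k, a⟩
  rcases e y with ⟨l, b⟩
  change blockDiagonal' (fun j => B j i) ⟨g k, a⟩ ⟨g l, b⟩ = _
  by_cases hkl : k = l
  · subst hkl
    simp only [blockDiagonal'_apply_eq]
  · rw [blockDiagonal'_apply_ne _ _ _ hkl, blockDiagonal'_apply_ne _ _ _ (g.injective.ne hkl)]

end

/-- If there are invertible `c₁, c₂` such that the scaled completely positive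
map `X ↦ c₁ (∑ᵢ Aᵢ (c₂ᴴ X c₂) Aᵢᴴ) c₁ᴴ` (with Kraus operators `c₁ Aᵢ c₂`) is doubly
stochastic, then the pencil `(A₁, …, A_r)` is LR-semisimple. -/
theorem ds_scalable_implies_lr_semisimple {n r : ℕ}
    (A : Fin r → Matrix (Fin n) (Fin n) ℂ)
    (c₁ c₂ : Matrix (Fin n) (Fin n) ℂ) (hc₁ : IsUnit c₁) (hc₂ : IsUnit c₂)
    (hunital : ∑ i, (c₁ * A i * c₂) * (c₁ * A i * c₂)ᴴ = 1)
    (htrace : ∑ i, (c₁ * A i * c₂)ᴴ * (c₁ * A i * c₂) = 1) :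
    PencilLRSemisimple A :=
  (IsDoublyStochasticPencil.isUnitarilySemisimple ⟨hunital, htrace⟩).pencilLRSemisimple hc₁ hc₂
end

section
/- Let A_1,…,A_r ∈ M_n(ℂ) and suppose the matrix pencil (A_1,…,A_r) is LR-semisimple. Then the completely positive map η(X) = ∑_{i=1}^r A_i X A_iᴴ is DS-scalable: there exist invertible matrices c_1, c_2 ∈ GL_n(ℂ) such that the scaled map X ↦ c_1 η(c_2ᴴ X c_2) c_1ᴴ is doubly stochastic. -/
open Matrix
open scoped ComplexOrder

namespace PencilScaling

section General

variable {ι κ : Type*} [Fintype ι] [Fintype κ]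

/-- The total squared modulus of the `(p, q)` entries of the matrices `Vᴴ * A i * U`. -/
noncomputable def weight (A : κ → Matrix ι ι ℂ) (V U : Matrix ι ι ℂ) (p q : ι) : ℝ :=
  ∑ i, ‖(Vᴴ * A i * U) p q‖ ^ 2

/-- The real part of `tr (P η(Q))`, where `η` is the map with Kraus operators `A i`. -/
noncomputable def energy (A : κ → Matrix ι ι ℂ) (P Q : Matrix ι ι ℂ) : ℝ :=
  ∑ i, (P * A i * Q * (A i)ᴴ).trace.re

theorem weight_nonneg (A : κ → Matrix ι ι ℂ) (V U : Matrix ι ι ℂ) (p q : ι) :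
    0 ≤ weight A V U p q :=
  Finset.sum_nonneg fun _ _ => by positivity

theorem energy_conjTranspose_mul_self (A : κ → Matrix ι ι ℂ) (g h : Matrix ι ι ℂ) :
    energy A (gᴴ * g) (h * hᴴ) = ∑ i, ((g * A i * h) * (g * A i * h)ᴴ).trace.re := by
  refine Finset.sum_congr rfl fun i _ => ?_
  simp only [Matrix.mul_assoc, conjTranspose_mul]
  rw [trace_mul_comm]
  simp only [Matrix.mul_assoc]

variable [DecidableEq ι]

theorem isCompact_unitaryGroup :
    IsCompact (unitaryGroup ι ℂ : Set (Matrix ι ι ℂ)) := by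
  have hK : IsCompact (Set.univ.pi fun _ : ι => Set.univ.pi fun _ : ι =>
      Metric.closedBall (0 : ℂ) 1) :=
    isCompact_univ_pi fun _ => isCompact_univ_pi fun _ => isCompact_closedBall _ _
  refine hK.of_isClosed_subset ?_ ?_
  · have : (unitaryGroup ι ℂ : Set (Matrix ι ι ℂ)) = {U | U * Uᴴ = 1} := by
      ext U
      exact mem_unitaryGroup_iff
    rw [this]
    exact isClosed_eq (by fun_prop) continuous_const
  · intro U hU i _ j _
    simpa using entry_norm_bound_of_unitary hU i j

/-- The matrix `U diag(d) Uᴴ`. -/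
noncomputable def conjDiagonal (U : Matrix ι ι ℂ) (d : ι → ℝ) : Matrix ι ι ℂ :=
  U * diagonal (fun i => (d i : ℂ)) * Uᴴ

theorem trace_diagonal_mul_mul (B : Matrix ι ι ℂ) (e d : ι → ℝ) :
    (diagonal (fun i => (e i : ℂ)) * B * diagonal (fun i => (d i : ℂ)) * Bᴴ).trace.re =
      ∑ p, ∑ q, e p * d q * ‖B p q‖ ^ 2 := by
  simp only [trace, diag_apply, mul_apply (N := Bᴴ), mul_diagonal, diagonal_mul,
    conjTranspose_apply, Complex.re_sum]
  refine Finset.sum_congr rfl fun p _ => Finset.sum_congr rfl fun q _ => ?_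
  have : (e p : ℂ) * B p q * d q * star (B p q) = ((e p * d q * ‖B p q‖ ^ 2 : ℝ) : ℂ) := by
    push_cast
    rw [← Complex.mul_conj', starRingEnd_apply]
    ring
  rw [this, Complex.ofReal_re]

theorem energy_conjDiagonal (A : κ → Matrix ι ι ℂ) (V U : Matrix ι ι ℂ) (e d : ι → ℝ) :
    energy A (conjDiagonal V e) (conjDiagonal U d) =
      ∑ p, ∑ q, e p * d q * weight A V U p q := by
  have (i : κ) : (conjDiagonal V e * A i * conjDiagonal U d * (A i)ᴴ).trace.re =
      ∑ p, ∑ q, e p * d q * ‖(Vᴴ * A i * U) p q‖ ^ 2 := by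
    rw [← trace_diagonal_mul_mul, conjDiagonal, conjDiagonal]
    simp only [Matrix.mul_assoc]
    rw [trace_mul_comm]
    simp only [Matrix.mul_assoc, conjTranspose_mul, conjTranspose_conjTranspose]
  simp only [energy, this, weight, Finset.mul_sum]
  rw [Finset.sum_comm]
  exact Finset.sum_congr rfl fun p _ => Finset.sum_comm

theorem exists_conjDiagonal_of_posSemidef {P : Matrix ι ι ℂ} (hP : P.PosSemidef)
    (hdet : P.det = 1) :
    ∃ V ∈ unitaryGroup ι ℂ, ∃ e : ι → ℝ, (∀ i, 0 ≤ e i) ∧ ∏ i, e i = 1 ∧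
      P = conjDiagonal V e := by
  refine ⟨hP.isHermitian.eigenvectorUnitary, hP.isHermitian.eigenvectorUnitary.2,
    hP.isHermitian.eigenvalues, hP.eigenvalues_nonneg, ?_, hP.isHermitian.spectral_theorem⟩
  have := hP.isHermitian.det_eq_prod_eigenvalues
  rw [hdet] at this
  rw [← RCLike.ofReal_prod] at this
  exact Complex.ofReal_injective (this.symm.trans Complex.ofReal_one.symm)

theorem norm_det_of_mem_unitaryGroup {U : Matrix ι ι ℂ} (hU : U ∈ unitaryGroup ι ℂ) :
    ‖U.det‖ = 1 := by
  have h := congrArg det (mem_unitaryGroup_iff.mp hU)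
  rw [star_eq_conjTranspose, det_mul, det_conjTranspose, ← starRingEnd_apply, Complex.mul_conj',
    det_one] at h
  exact (pow_eq_one_iff_of_nonneg (norm_nonneg _) two_ne_zero).mp (by exact_mod_cast h)

theorem conjDiagonal_eq_mul_conjTranspose (U : Matrix ι ι ℂ) {d : ι → ℝ} (hd : ∀ i, 0 ≤ d i) :
    conjDiagonal U d = (U * diagonal fun i => (√(d i) : ℂ)) *
      (U * diagonal fun i => (√(d i) : ℂ))ᴴ := by
  have hs : (diagonal fun i => (√(d i) : ℂ)) * (diagonal fun i => (√(d i) : ℂ))ᴴ =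
      diagonal fun i => (d i : ℂ) := by
    rw [diagonal_conjTranspose, diagonal_mul_diagonal]
    congr 1
    ext i
    simp [← Complex.ofReal_mul, Real.mul_self_sqrt (hd i)]
  rw [conjDiagonal, conjTranspose_mul, ← hs]
  simp only [Matrix.mul_assoc]

theorem norm_det_mul_diagonal_sqrt {U : Matrix ι ι ℂ} (hU : U ∈ unitaryGroup ι ℂ) {d : ι → ℝ}
    (hd : ∀ i, 0 ≤ d i) (hprod : ∏ i, d i = 1) :
    ‖(U * diagonal fun i => (√(d i) : ℂ)).det‖ = 1 := by
  rw [det_mul, norm_mul, det_diagonal, ← Complex.ofReal_prod, ← Real.sqrt_prod _ (fun i _ => hd i),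
    hprod, norm_det_of_mem_unitaryGroup hU]
  simp

theorem det_mul_conjTranspose_eq_one {g : Matrix ι ι ℂ} (hg : ‖g.det‖ = 1) :
    (g * gᴴ).det = 1 := by
  rw [det_mul, det_conjTranspose, ← starRingEnd_apply, Complex.mul_conj', hg]
  simp

/-- A positive semidefinite matrix whose trace is minimal among its congruence transforms by
matrices of determinant of modulus one is scalar. -/
theorem eq_smul_one_of_trace_minimal {G : Matrix ι ι ℂ} (hG : G.PosSemidef)
    (hmin : ∀ s : Matrix ι ι ℂ, ‖s.det‖ = 1 → G.trace.re ≤ (s * G * sᴴ).trace.re) :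
    ∃ c : ℝ, G = (c : ℂ) • (1 : Matrix ι ι ℂ) := by
  have hW := hG.isHermitian.eigenvectorUnitary.2
  have hspec : G = conjDiagonal (hG.isHermitian.eigenvectorUnitary : Matrix ι ι ℂ)
    hG.isHermitian.eigenvalues := hG.isHermitian.spectral_theorem
  have hnn := hG.eigenvalues_nonneg
  generalize (hG.isHermitian.eigenvectorUnitary : Matrix ι ι ℂ) = W at hW hspec
  generalize hG.isHermitian.eigenvalues = l at hspec hnn
  have hWW : Wᴴ * W = 1 := mem_unitaryGroup_iff'.mp hW
  have hWW' : W * Wᴴ = 1 := mem_unitaryGroup_iff.mp hW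
  have htrace : G.trace.re = ∑ i, l i := by
    rw [hspec, conjDiagonal, trace_mul_comm, ← Matrix.mul_assoc, hWW, Matrix.one_mul,
      trace_diagonal, ← Complex.ofReal_sum, Complex.ofReal_re]
  have hscale (x : ι → ℝ) (hx : ∏ i, x i = 1) : ∑ i, l i ≤ ∑ i, x i ^ 2 * l i := by
    have hdet : ‖((diagonal fun i => (x i : ℂ)) * Wᴴ).det‖ = 1 := by
      rw [det_mul, norm_mul, det_diagonal, ← Complex.ofReal_prod, hx,
        det_conjTranspose, norm_star,
          norm_det_of_mem_unitaryGroup hW]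
      simp
    have h := hmin _ hdet
    have hconj : (diagonal fun i => (x i : ℂ)) * Wᴴ * G *
        ((diagonal fun i => (x i : ℂ)) * Wᴴ)ᴴ = diagonal fun i => ((x i ^ 2 * l i : ℝ) : ℂ) := by
      rw [hspec, conjDiagonal, conjTranspose_mul, conjTranspose_conjTranspose]
      simp only [Matrix.mul_assoc]
      rw [← Matrix.mul_assoc Wᴴ W, hWW, Matrix.one_mul, ← Matrix.mul_assoc Wᴴ W, hWW,
        Matrix.one_mul, diagonal_conjTranspose, diagonal_mul_diagonal, diagonal_mul_diagonal]
      congr 1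
      ext i
      simp
      ring
    rwa [htrace, hconj, trace_diagonal, ← Complex.ofReal_sum, Complex.ofReal_re] at h
  have hle (p q : ι) : l q ≤ l p := by
    by_contra! hlt
    have hpq : p ≠ q := by rintro rfl; exact lt_irrefl _ hlt
    have hq : 0 < l q := (hnn p).trans_lt hlt
    set y : ℝ := (l p + l q) / (2 * l q) with hy
    have hypos : 0 < y := by have := hnn p; positivity
    have hylq : y * l q = (l p + l q) / 2 := by rw [hy]; field_simp
    have hsq : √y ^ 2 = y := Real.sq_sqrt hypos.le
    have hs : 0 < √y := Real.sqrt_pos.mpr hypos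
    set x : ι → ℝ := fun i => if i = p then (√y)⁻¹ else if i = q then √y else 1 with hx
    have hxp : x p = (√y)⁻¹ := by simp [hx]
    have hxq : x q = √y := by simp [hx, hpq.symm]
    have hxo (i) (hi : i ≠ p ∧ i ≠ q) : x i = 1 := by simp [hx, hi.1, hi.2]
    have h := hscale x (by
      rw [Fintype.prod_eq_mul p q hpq hxo, hxp, hxq, inv_mul_cancel₀ hs.ne'])
    have h' : 0 ≤ ∑ i, (x i ^ 2 - 1) * l i := by
      simp only [sub_mul, one_mul, Finset.sum_sub_distrib]
      linarith
    rw [Fintype.sum_eq_add p q hpq (fun i hi => by simp [hxo i hi]), hxp, hxq, inv_pow, hsq] at h'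
    have hy1 : y < 1 := by rw [hy, div_lt_one (by positivity)]; linarith
    have h2 : 0 ≤ (1 - y) * (l p - y * l q) := by
      have := mul_nonneg hypos.le h'
      field_simp at this
      nlinarith
    nlinarith
  rcases isEmpty_or_nonempty ι with hι | ⟨⟨p⟩⟩
  · exact ⟨0, by ext i; exact hι.elim i⟩
  · refine ⟨l p, ?_⟩
    have : (fun i => (l i : ℂ)) = fun _ => (l p : ℂ) :=
      funext fun i => congrArg _ (le_antisymm (hle p i) (hle i p))
    rw [hspec, conjDiagonal, this, ← smul_one_eq_diagonal]
    simp [hWW']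

end General

section Unsplittable

variable {n r : ℕ} {A : Fin r → Matrix (Fin n) (Fin n) ℂ}

theorem finrank_span_range_col {U : Matrix (Fin n) (Fin n) ℂ} (hU : IsUnit U)
    (S : Finset (Fin n)) :
    Module.finrank ℂ (Submodule.span ℂ (U.col '' S)) = S.card := by
  have hli : LinearIndependent ℂ fun i : S => U.col i :=
    (linearIndependent_cols_iff_isUnit.mpr hU).comp _ Subtype.val_injective
  have h := finrank_span_eq_card hli
  rw [Fintype.card_coe] at h
  rw [← h, Set.image_eq_range]
  rfl

theorem exists_weight_pos (hA : PencilUnsplittable A) {V U : Matrix (Fin n) (Fin n) ℂ}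
    (hV : V ∈ unitaryGroup (Fin n) ℂ) (hU : U ∈ unitaryGroup (Fin n) ℂ) {S T : Finset (Fin n)}
    (hS : S.Nonempty) (hT : T.Nonempty) (hcard : S.card + T.card = n) :
    ∃ p ∈ T, ∃ q ∈ S, 0 < weight A V U p q := by
  by_contra! hzero
  have hVV : V * Vᴴ = 1 := mem_unitaryGroup_iff.mp hV
  have hUU : U * Uᴴ = 1 := mem_unitaryGroup_iff.mp hU
  have hz (i : Fin r) {p q} (hp : p ∈ T) (hq : q ∈ S) : (Vᴴ * A i * U) p q = 0 := by
    have h0 := le_antisymm (hzero p hp q hq) (weight_nonneg A V U p q)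
    rw [weight, Finset.sum_eq_zero_iff_of_nonneg fun _ _ => by positivity] at h0
    simpa using h0 i (Finset.mem_univ i)
  have hSR := finrank_span_range_col (IsUnit.of_mul_eq_one _ hUU) S
  have hTL := finrank_span_range_col (IsUnit.of_mul_eq_one _ hVV) Tᶜ
  rw [Finset.card_compl, Fintype.card_fin] at hTL
  have hS1 := hS.card_pos
  have hT1 := hT.card_pos
  refine hA.2 ⟨Submodule.span ℂ (U.col '' S), Submodule.span ℂ (V.col '' ↑(Tᶜ)), by omega,
    by omega, by omega, fun i => ?_⟩
  rw [Submodule.map_span_le]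
  rintro _ ⟨q, hq, rfl⟩
  have hcol : (A i).mulVecLin (U.col q) = ∑ p, (Vᴴ * A i * U) p q • V.col p := by
    have : A i * U = V * (Vᴴ * A i * U) := by
      simp only [← Matrix.mul_assoc, hVV, Matrix.one_mul]
    ext k
    have hk := congrFun (congrFun this k) q
    rw [mul_apply, mul_apply] at hk
    simpa [mulVec, dotProduct, mul_comm] using hk
  rw [hcol]
  refine Submodule.sum_mem _ fun p _ => ?_
  by_cases hp : p ∈ T
  · rw [hz i hp hq, zero_smul]
    exact zero_mem _
  · exact Submodule.smul_mem _ _ (Submodule.subset_span ⟨p, by simpa using hp, rfl⟩)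

/-- The support of the weight matrix of an unsplittable pencil contains, for every position
`(p₀, q₀)`, a permutation through `(p₀, q₀)`, up to that position itself. -/
theorem exists_perm_weight_pos (hA : PencilUnsplittable A) {V U : Matrix (Fin n) (Fin n) ℂ}
    (hV : V ∈ unitaryGroup (Fin n) ℂ) (hU : U ∈ unitaryGroup (Fin n) ℂ) (p₀ q₀ : Fin n) :
    ∃ σ : Equiv.Perm (Fin n), σ q₀ = p₀ ∧ ∀ q, q ≠ q₀ → 0 < weight A V U (σ q) q := by
  classical
  set t : Fin n → Finset (Fin n) := fun q =>
    if q = q₀ then {p₀} else Finset.univ.filter fun p => p ≠ p₀ ∧ 0 < weight A V U p q with ht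
  have hoff (S : Finset (Fin n)) (hS : q₀ ∉ S) : S.card ≤ (S.biUnion t).card := by
    rcases S.eq_empty_or_nonempty with rfl | hne
    · simp
    set N : Finset (Fin n) := {p | ∃ q ∈ S, 0 < weight A V U p q} with hN
    have hlt : S.card < N.card := by
      by_contra! hle
      have hSn : S.card < n := by
        simpa using Finset.card_lt_univ_of_notMem hS
      obtain ⟨T, hTN, hTc⟩ := Finset.exists_subset_card_eq (s := Nᶜ) (n := n - S.card) (by
        rw [Finset.card_compl, Fintype.card_fin]; omega)
      obtain ⟨p, hp, q, hq, hpos⟩ := exists_weight_pos hA hV hU hne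
        (Finset.card_pos.mp (by omega : 0 < T.card)) (by omega)
      have := hTN hp
      simp only [hN, Finset.mem_compl, Finset.mem_filter, Finset.mem_univ, true_and] at this
      exact this ⟨q, hq, hpos⟩
    have hsub : N.erase p₀ ⊆ S.biUnion t := by
      intro p hp
      simp only [hN, Finset.mem_erase, Finset.mem_filter, Finset.mem_univ, true_and] at hp
      obtain ⟨hp0, q, hq, hpos⟩ := hp
      have hq0 : q ≠ q₀ := fun h => hS (h ▸ hq)
      exact Finset.mem_biUnion.mpr ⟨q, hq, by simp [ht, hq0, hp0, hpos]⟩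
    have := Finset.card_le_card hsub
    have := Finset.pred_card_le_card_erase (s := N) (a := p₀)
    omega
  have hall (S : Finset (Fin n)) : S.card ≤ (S.biUnion t).card := by
    by_cases hS : q₀ ∈ S
    · have h := hoff (S.erase q₀) (by simp)
      have hnot : p₀ ∉ (S.erase q₀).biUnion t := by
        simp only [Finset.mem_biUnion, not_exists, not_and]
        intro q hq
        simp [ht, Finset.ne_of_mem_erase hq]
      rw [← Finset.insert_erase hS, Finset.biUnion_insert, Finset.card_insert_of_notMem (by simp)]
      have : t q₀ = {p₀} := by simp [ht]
      rw [this, ← Finset.insert_eq, Finset.card_insert_of_notMem hnot]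
      omega
    · exact hoff S hS
  obtain ⟨f, hf, hft⟩ := (Finset.all_card_le_biUnion_card_iff_exists_injective t).mp hall
  refine ⟨Equiv.ofBijective f (Finite.injective_iff_bijective.mp hf), ?_, fun q hq => ?_⟩
  · simpa [ht] using hft q₀
  · have := hft q
    simp only [ht, hq, if_false, Finset.mem_filter, Finset.mem_univ, true_and] at this
    exact this.2

/-- The sum of the products of weights along the permutations through `(p₀, q₀)`, with the
position `(p₀, q₀)` left out: a permanental minor of the weight matrix. -/
noncomputable def permMinor (A : Fin r → Matrix (Fin n) (Fin n) ℂ) (p₀ q₀ : Fin n)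
    (V U : Matrix (Fin n) (Fin n) ℂ) : ℝ :=
  ∑ σ : Equiv.Perm (Fin n) with σ q₀ = p₀, ∏ q ∈ Finset.univ.erase q₀, weight A V U (σ q) q

theorem exists_permMinor_lower_bound (hA : PencilUnsplittable A) :
    ∃ δ > 0, ∀ V ∈ unitaryGroup (Fin n) ℂ, ∀ U ∈ unitaryGroup (Fin n) ℂ, ∀ p q,
      δ ≤ permMinor A p q V U := by
  have hK : IsCompact ((unitaryGroup (Fin n) ℂ : Set (Matrix (Fin n) (Fin n) ℂ)) ×ˢ
      (unitaryGroup (Fin n) ℂ : Set (Matrix (Fin n) (Fin n) ℂ))) :=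
    isCompact_unitaryGroup.prod isCompact_unitaryGroup
  have hpq (pq : Fin n × Fin n) : ∃ δ > 0, ∀ V ∈ unitaryGroup (Fin n) ℂ,
      ∀ U ∈ unitaryGroup (Fin n) ℂ, δ ≤ permMinor A pq.1 pq.2 V U := by
    have hcont : Continuous fun x : Matrix (Fin n) (Fin n) ℂ × Matrix (Fin n) (Fin n) ℂ =>
        permMinor A pq.1 pq.2 x.1 x.2 := by
      unfold permMinor weight
      fun_prop
    obtain ⟨x, hx, hmin⟩ :=
      hK.exists_isMinOn ⟨(1, 1), one_mem _, one_mem _⟩ hcont.continuousOn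
    refine ⟨_, ?_, fun V hV U hU => isMinOn_iff.mp hmin (V, U) ⟨hV, hU⟩⟩
    obtain ⟨σ, hσ, hpos⟩ := exists_perm_weight_pos hA hx.1 hx.2 pq.1 pq.2
    refine Finset.sum_pos' (fun τ _ => Finset.prod_nonneg fun q _ => weight_nonneg ..)
      ⟨σ, by simpa using hσ, Finset.prod_pos fun q hq => hpos q (Finset.ne_of_mem_erase hq)⟩
  choose δ hδ hle using hpq
  rcases isEmpty_or_nonempty (Fin n × Fin n) with hn | hn
  · exact ⟨1, one_pos, fun V _ U _ p q => isEmptyElim (p, q)⟩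
  · exact ⟨Finset.univ.inf' Finset.univ_nonempty δ,
      (Finset.lt_inf'_iff _).mpr fun i _ => hδ i,
      fun V hV U hU p q => (Finset.inf'_le δ (Finset.mem_univ (p, q))).trans (hle (p, q) V hV U hU)⟩

theorem permMinor_le {V U : Matrix (Fin n) (Fin n) ℂ} {e d : Fin n → ℝ} (he : ∀ i, 0 ≤ e i)
    (hd : ∀ i, 0 ≤ d i) (hep : ∏ i, e i = 1) (hdp : ∏ i, d i = 1) {F : ℝ}
    (hF : energy A (conjDiagonal V e) (conjDiagonal U d) ≤ F) (p q : Fin n) :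
    permMinor A p q V U ≤ (n.factorial * F ^ (n - 1)) * (e p * d q) := by
  have hnn (p q) : 0 ≤ e p * d q * weight A V U p q :=
    mul_nonneg (mul_nonneg (he p) (hd q)) (weight_nonneg ..)
  have hterm (p q) : e p * d q * weight A V U p q ≤ F := by
    rw [energy_conjDiagonal] at hF
    refine le_trans ?_ hF
    exact (Finset.single_le_sum (f := fun q => e p * d q * weight A V U p q)
      (fun q _ => hnn p q) (Finset.mem_univ q)).trans
      (Finset.single_le_sum (f := fun p => ∑ q, e p * d q * weight A V U p q)
        (fun p _ => Finset.sum_nonneg fun q _ => hnn p q) (Finset.mem_univ p))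
  have hF0 : 0 ≤ F := (hnn p q).trans (hterm p q)
  have hperm (σ : Equiv.Perm (Fin n)) (hσ : σ q = p) :
      ∏ k ∈ Finset.univ.erase q, weight A V U (σ k) k ≤ F ^ (n - 1) * (e p * d q) := by
    have hprod : (e p * d q) * ∏ k ∈ Finset.univ.erase q, (e (σ k) * d k) = 1 := by
      rw [← hσ, Finset.mul_prod_erase _ (fun k => e (σ k) * d k) (Finset.mem_univ q),
        Finset.prod_mul_distrib, hdp, Equiv.prod_comp σ e, hep, one_mul]
    have hle : ∏ k ∈ Finset.univ.erase q, (e (σ k) * d k * weight A V U (σ k) k) ≤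
        F ^ (n - 1) := by
      simpa using Finset.prod_le_prod (s := Finset.univ.erase q) (g := fun _ => F)
        (fun k _ => hnn (σ k) k) (fun k _ => hterm (σ k) k)
    rw [Finset.prod_mul_distrib] at hle
    have := mul_le_mul_of_nonneg_left hle (mul_nonneg (he p) (hd q))
    rw [← mul_assoc, hprod, one_mul] at this
    linarith
  calc permMinor A p q V U
      ≤ ∑ σ : Equiv.Perm (Fin n) with σ q = p, F ^ (n - 1) * (e p * d q) :=
        Finset.sum_le_sum fun σ hσ => hperm σ (by simpa using hσ)
    _ ≤ ∑ σ : Equiv.Perm (Fin n), F ^ (n - 1) * (e p * d q) :=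
        Finset.sum_le_sum_of_subset_of_nonneg (Finset.filter_subset _ _) fun _ _ _ =>
          mul_nonneg (pow_nonneg hF0 _) (mul_nonneg (he p) (hd q))
    _ = (n.factorial * F ^ (n - 1)) * (e p * d q) := by
        simp [Fintype.card_perm, mul_assoc]

theorem le_inv_pow_of_forall_le_mul {e d : Fin n → ℝ} (hd : ∀ i, 0 ≤ d i)
    (hep : ∏ i, e i = 1) (hdp : ∏ i, d i = 1) {c : ℝ} (hc : 0 < c)
    (h : ∀ p q, c ≤ e p * d q) (q : Fin n) : d q ≤ (c ^ (n - 1))⁻¹ := by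
  have hcd (q : Fin n) : c ≤ d q := by
    have : c ^ n ≤ d q ^ n := by
      calc c ^ n = ∏ _p : Fin n, c := by simp
        _ ≤ ∏ p, e p * d q := Finset.prod_le_prod (fun _ _ => hc.le) fun p _ => h p q
        _ = d q ^ n := by simp [Finset.prod_mul_distrib, hep]
    exact le_of_pow_le_pow_left₀ (Fin.pos q).ne' (hd q) this
  rw [le_inv_comm₀ (hc.trans_le (hcd q)) (pow_pos hc _), inv_eq_one_div,
    le_div_iff₀ (hc.trans_le (hcd q))]
  calc c ^ (n - 1) * d q = (∏ _k ∈ Finset.univ.erase q, c) * d q := by simp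
    _ ≤ (∏ k ∈ Finset.univ.erase q, d k) * d q :=
      mul_le_mul_of_nonneg_right (Finset.prod_le_prod (fun _ _ => hc.le) fun k _ => hcd k) (hd q)
    _ = 1 := by rw [Finset.prod_erase_mul _ _ (Finset.mem_univ q), hdp]

theorem exists_sublevel_bound (hA : PencilUnsplittable A) (F : ℝ) :
    ∃ C : ℝ, ∀ V ∈ unitaryGroup (Fin n) ℂ, ∀ U ∈ unitaryGroup (Fin n) ℂ, ∀ e d : Fin n → ℝ,
      (∀ i, 0 ≤ e i) → (∀ i, 0 ≤ d i) → ∏ i, e i = 1 → ∏ i, d i = 1 →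
      energy A (conjDiagonal V e) (conjDiagonal U d) ≤ F → ∀ i, e i ≤ C ∧ d i ≤ C := by
  obtain ⟨δ, hδ, hle⟩ := exists_permMinor_lower_bound hA
  set K : ℝ := n.factorial * max F 1 ^ (n - 1) with hK
  have hKpos : 0 < K := by positivity
  refine ⟨((δ / K) ^ (n - 1))⁻¹, fun V hV U hU e d he hd hep hdp hF => ?_⟩
  have h (p q) : δ / K ≤ e p * d q := by
    rw [div_le_iff₀' hKpos]
    exact (hle V hV U hU p q).trans
      (permMinor_le he hd hep hdp (hF.trans (le_max_left F 1)) p q)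
  exact fun i => ⟨le_inv_pow_of_forall_le_mul he hdp hep (by positivity)
    (fun p q => by rw [mul_comm]; exact h q p) i,
    le_inv_pow_of_forall_le_mul hd hep hdp (by positivity) h i⟩

theorem exists_energy_minimizer (hA : PencilUnsplittable A) :
    ∃ V ∈ unitaryGroup (Fin n) ℂ, ∃ U ∈ unitaryGroup (Fin n) ℂ, ∃ e d : Fin n → ℝ,
      (∀ i, 0 ≤ e i) ∧ (∀ i, 0 ≤ d i) ∧ ∏ i, e i = 1 ∧ ∏ i, d i = 1 ∧
      ∀ P Q : Matrix (Fin n) (Fin n) ℂ, P.PosSemidef → Q.PosSemidef → P.det = 1 → Q.det = 1 →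
        energy A (conjDiagonal V e) (conjDiagonal U d) ≤ energy A P Q := by
  set F := energy A (conjDiagonal 1 1) (conjDiagonal 1 1) with hF
  obtain ⟨C, hC⟩ := exists_sublevel_bound hA F
  set D : Set (Fin n → ℝ) := (Set.univ.pi fun _ => Set.Icc 0 C) ∩ {d | ∏ i, d i = 1} with hD
  have hDc : IsCompact D :=
    (isCompact_univ_pi fun _ => isCompact_Icc).inter_right
      (isClosed_eq (by fun_prop) continuous_const)
  have hW := isCompact_unitaryGroup (ι := Fin n)
  have hK := (hW.prod hW).prod (hDc.prod hDc)
  have h1 : (1 : Fin n → ℝ) ∈ D := by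
    refine ⟨fun i _ => ⟨zero_le_one, ?_⟩, by simp⟩
    exact (hC 1 (one_mem _) 1 (one_mem _) 1 1 (by simp) (by simp) (by simp) (by simp) le_rfl i).1
  have h1K : ((1, 1), (1, 1)) ∈ ((unitaryGroup (Fin n) ℂ : Set (Matrix (Fin n) (Fin n) ℂ)) ×ˢ
      (unitaryGroup (Fin n) ℂ : Set (Matrix (Fin n) (Fin n) ℂ))) ×ˢ (D ×ˢ D) :=
    ⟨⟨one_mem _, one_mem _⟩, h1, h1⟩
  have hcont : Continuous fun x : (Matrix (Fin n) (Fin n) ℂ × Matrix (Fin n) (Fin n) ℂ) ×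
      ((Fin n → ℝ) × (Fin n → ℝ)) =>
      energy A (conjDiagonal x.1.1 x.2.1) (conjDiagonal x.1.2 x.2.2) := by
    unfold energy conjDiagonal
    fun_prop
  obtain ⟨⟨⟨V, U⟩, e, d⟩, ⟨⟨hV, hU⟩, he, hd⟩, hmin⟩ :=
    hK.exists_isMinOn ⟨_, h1K⟩ hcont.continuousOn
  refine ⟨V, hV, U, hU, e, d, fun i => (he.1 i trivial).1, fun i => (hd.1 i trivial).1,
    he.2, hd.2, fun P Q hP hQ hPd hQd => ?_⟩
  obtain ⟨V', hV', e', he', hep', rfl⟩ := exists_conjDiagonal_of_posSemidef hP hPd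
  obtain ⟨U', hU', d', hd', hdp', rfl⟩ := exists_conjDiagonal_of_posSemidef hQ hQd
  by_cases hle : energy A (conjDiagonal V' e') (conjDiagonal U' d') ≤ F
  · have hb := hC V' hV' U' hU' e' d' he' hd' hep' hdp' hle
    exact isMinOn_iff.mp hmin ((V', U'), e', d') ⟨⟨hV', hU'⟩,
      ⟨fun i _ => ⟨he' i, (hb i).1⟩, hep'⟩, ⟨fun i _ => ⟨hd' i, (hb i).2⟩, hdp'⟩⟩
  · exact (isMinOn_iff.mp hmin _ h1K).trans (not_le.mp hle).le

end Unsplittable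

section Scaling

variable {n r : ℕ} {A : Fin r → Matrix (Fin n) (Fin n) ℂ}

theorem isUnit_of_norm_det_eq_one {g : Matrix (Fin n) (Fin n) ℂ} (hg : ‖g.det‖ = 1) :
    IsUnit g := by
  rw [isUnit_iff_isUnit_det, isUnit_iff_ne_zero]
  intro h
  simp [h] at hg

/-- There are `g` and `h` with determinants of modulus one that minimize `∑ ‖g Aᵢ h‖²`. -/
theorem exists_norm_minimizer (hA : PencilUnsplittable A) :
    ∃ g h : Matrix (Fin n) (Fin n) ℂ, ‖g.det‖ = 1 ∧ ‖h.det‖ = 1 ∧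
      ∀ g' h' : Matrix (Fin n) (Fin n) ℂ, ‖g'.det‖ = 1 → ‖h'.det‖ = 1 →
        ∑ i, ((g * A i * h) * (g * A i * h)ᴴ).trace.re ≤
          ∑ i, ((g' * A i * h') * (g' * A i * h')ᴴ).trace.re := by
  obtain ⟨V, hV, U, hU, e, d, he, hd, hep, hdp, hmin⟩ := exists_energy_minimizer hA
  refine ⟨(V * diagonal fun i => (√(e i) : ℂ))ᴴ, U * diagonal fun i => (√(d i) : ℂ),
    by rw [det_conjTranspose, norm_star, norm_det_mul_diagonal_sqrt hV he hep],
    norm_det_mul_diagonal_sqrt hU hd hdp, fun g' h' hg' hh' => ?_⟩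
  rw [← energy_conjTranspose_mul_self, ← energy_conjTranspose_mul_self, conjTranspose_conjTranspose,
    ← conjDiagonal_eq_mul_conjTranspose V he, ← conjDiagonal_eq_mul_conjTranspose U hd]
  refine hmin _ _ (posSemidef_conjTranspose_mul_self g') (posSemidef_self_mul_conjTranspose h') ?_
    (det_mul_conjTranspose_eq_one hh')
  simpa using det_mul_conjTranspose_eq_one (g := g'ᴴ) (by rwa [det_conjTranspose, norm_star])

theorem exists_scaling_of_unsplittable (hA : PencilUnsplittable A) :
    ∃ c₁ c₂ : Matrix (Fin n) (Fin n) ℂ, IsUnit c₁ ∧ IsUnit c₂ ∧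
      ∑ i, (c₁ * A i * c₂) * (c₁ * A i * c₂)ᴴ = 1 ∧
      ∑ i, (c₁ * A i * c₂)ᴴ * (c₁ * A i * c₂) = 1 := by
  obtain ⟨g, h, hg, hh, hmin⟩ := exists_norm_minimizer hA
  have hgu := isUnit_of_norm_det_eq_one hg
  have hhu := isUnit_of_norm_det_eq_one hh
  set B : Fin r → Matrix (Fin n) (Fin n) ℂ := fun i => g * A i * h with hB
  have htr : (∑ i, (B i)ᴴ * B i).trace = (∑ i, B i * (B i)ᴴ).trace := by
    simp only [trace_sum]
    exact Finset.sum_congr rfl fun i _ => trace_mul_comm _ _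
  have hre : (∑ i, B i * (B i)ᴴ).trace.re = ∑ i, (B i * (B i)ᴴ).trace.re := by
    rw [trace_sum, Complex.re_sum]
  obtain ⟨a, ha⟩ := eq_smul_one_of_trace_minimal (G := ∑ i, B i * (B i)ᴴ)
    (posSemidef_sum _ fun i _ => posSemidef_self_mul_conjTranspose (B i)) fun s hs => by
      rw [hre, Finset.mul_sum, Finset.sum_mul, trace_sum, Complex.re_sum]
      refine (hmin (s * g) h (by rw [det_mul, norm_mul, hs, hg, one_mul]) hh).trans_eq ?_
      simp only [hB, conjTranspose_mul, Matrix.mul_assoc]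
  obtain ⟨b, hb⟩ := eq_smul_one_of_trace_minimal (G := ∑ i, (B i)ᴴ * B i)
    (posSemidef_sum _ fun i _ => posSemidef_conjTranspose_mul_self (B i)) fun s hs => by
      rw [htr, hre, Finset.mul_sum, Finset.sum_mul, trace_sum, Complex.re_sum]
      refine (hmin g (h * sᴴ) hg
        (by rw [det_mul, norm_mul, det_conjTranspose, norm_star, hs, hh, one_mul])).trans_eq ?_
      refine Finset.sum_congr rfl fun i _ => ?_
      rw [trace_mul_comm]
      simp only [hB, conjTranspose_mul, conjTranspose_conjTranspose, Matrix.mul_assoc]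
  obtain ⟨i₀, hi₀⟩ := hA.1
  have hn : (n : ℂ) ≠ 0 := by
    rw [Nat.cast_ne_zero]
    rintro rfl
    exact hi₀ (Subsingleton.elim _ _)
  have hab : a = b := by
    rw [ha, hb] at htr
    simpa [hn] using htr.symm
  have hBne : B i₀ ≠ 0 := by
    simpa [hB, hgu.mul_right_eq_zero, hhu.mul_left_eq_zero] using hi₀
  have hapos : 0 < a := by
    have hpos : 0 < (∑ i, B i * (B i)ᴴ).trace := by
      rw [trace_sum]
      refine Finset.sum_pos' (fun i _ => (posSemidef_self_mul_conjTranspose (B i)).trace_nonneg)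
        ⟨i₀, Finset.mem_univ _, lt_of_le_of_ne
          (posSemidef_self_mul_conjTranspose (B i₀)).trace_nonneg fun h0 => hBne ?_⟩
      exact trace_mul_conjTranspose_self_eq_zero_iff.mp h0.symm
    rw [ha, trace_smul, trace_one, Fintype.card_fin, smul_eq_mul] at hpos
    have : 0 < a * n := by exact_mod_cast hpos
    exact pos_of_mul_pos_left this (Nat.cast_nonneg n)
  have hs : (√a : ℂ) ≠ 0 := by exact_mod_cast (Real.sqrt_pos.mpr hapos).ne'
  have hss : (√a : ℂ)⁻¹ * (√a : ℂ)⁻¹ * (a : ℂ) = 1 := by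
    rw [← mul_inv, ← Complex.ofReal_mul, Real.mul_self_sqrt hapos.le]
    exact inv_mul_cancel₀ (by exact_mod_cast hapos.ne')
  refine ⟨(√a : ℂ)⁻¹ • g, h, ?_, hhu, ?_, ?_⟩
  · exact (isUnit_smul_iff (Units.mk0 _ (inv_ne_zero hs)) g).mpr hgu
  · simp only [Matrix.smul_mul, conjTranspose_smul, Matrix.mul_smul, smul_smul, ← Finset.smul_sum]
    rw [show ∑ i, g * A i * h * (g * A i * h)ᴴ = (a : ℂ) • 1 from ha, smul_smul]
    simp [hss]
  · simp only [Matrix.smul_mul, conjTranspose_smul, Matrix.mul_smul, smul_smul, ← Finset.smul_sum]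
    rw [show ∑ i, (g * A i * h)ᴴ * (g * A i * h) = (b : ℂ) • 1 from hb, ← hab, smul_smul]
    simp [hss]

theorem sum_blockDiagonal'_submatrix {ι κ μ : Type*} [DecidableEq κ] {m : κ → Type*}
    [Fintype ι] (e : μ → Σ j, m j) (M : ι → ∀ j, Matrix (m j) (m j) ℂ) :
    ∑ i, (blockDiagonal' (M i)).submatrix e e =
      (blockDiagonal' fun j => ∑ i, M i j).submatrix e e := by
  have h := map_sum (blockDiagonal'AddMonoidHom m m ℂ) M Finset.univ
  rw [Finset.sum_fn] at h
  refine Eq.trans ?_ (congrArg (submatrix · e e) h.symm)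
  ext
  simp [Matrix.sum_apply]

theorem isUnit_blockDiagonal'_submatrix {ι κ : Type*} [Fintype ι] [DecidableEq ι] [Fintype κ]
    [DecidableEq κ] {m : κ → Type*} [∀ j, Fintype (m j)] [∀ j, DecidableEq (m j)]
    (e : ι ≃ Σ j, m j) {M : ∀ j, Matrix (m j) (m j) ℂ} (hM : ∀ j, IsUnit (M j)) :
    IsUnit ((blockDiagonal' M).submatrix e e) := by
  rw [isUnit_submatrix_equiv]
  refine IsUnit.of_mul_eq_one (blockDiagonal' fun j => (M j)⁻¹) ?_
  rw [← blockDiagonal'_mul, ← blockDiagonal'_one]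
  congr 1
  ext1 j
  exact mul_nonsing_inv _ ((isUnit_iff_isUnit_det _).mp (hM j))

end Scaling

end PencilScaling

/-- If the pencil `(A₁, …, A_r)` is LR-semisimple, then the completely
positive map `η(X) = ∑ᵢ Aᵢ X Aᵢᴴ` is DS-scalable: there are invertible `c₁, c₂` such that the
scaled map `X ↦ c₁ η(c₂ᴴ X c₂) c₁ᴴ` (with Kraus operators `c₁ Aᵢ c₂`) is doubly stochastic. -/
theorem lr_semisimple_implies_ds_scalable {n r : ℕ}
    (A : Fin r → Matrix (Fin n) (Fin n) ℂ) (h : PencilLRSemisimple A) :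
    ∃ c₁ c₂ : Matrix (Fin n) (Fin n) ℂ, IsUnit c₁ ∧ IsUnit c₂ ∧
      ∑ i, (c₁ * A i * c₂) * (c₁ * A i * c₂)ᴴ = 1 ∧
      ∑ i, (c₁ * A i * c₂)ᴴ * (c₁ * A i * c₂) = 1 := by
  obtain ⟨L, R, hL, hR, k, d, B, e, hLR, hB⟩ := h
  choose C₁ C₂ hC₁ hC₂ hleft hright using
    fun j => PencilScaling.exists_scaling_of_unsplittable (hB j)
  have hprod (i : Fin r) : (blockDiagonal' C₁).submatrix e e * L * A i *
      (R * (blockDiagonal' C₂).submatrix e e) =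
        (blockDiagonal' fun j => C₁ j * B j i * C₂ j).submatrix e e := by
    calc _ = (blockDiagonal' C₁).submatrix e e * (L * A i * R) *
          (blockDiagonal' C₂).submatrix e e := by simp only [Matrix.mul_assoc]
      _ = _ := by
        rw [hLR, submatrix_mul_equiv, submatrix_mul_equiv, ← blockDiagonal'_mul,
          ← blockDiagonal'_mul]
  refine ⟨(blockDiagonal' C₁).submatrix e e * L, R * (blockDiagonal' C₂).submatrix e e,
    (PencilScaling.isUnit_blockDiagonal'_submatrix e hC₁).mul hL,
    hR.mul (PencilScaling.isUnit_blockDiagonal'_submatrix e hC₂), ?_, ?_⟩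
  · simp only [hprod, conjTranspose_submatrix, submatrix_mul_equiv, blockDiagonal'_conjTranspose,
      ← blockDiagonal'_mul]
    rw [PencilScaling.sum_blockDiagonal'_submatrix, funext hleft]
    exact (congrArg (submatrix · e e) blockDiagonal'_one).trans (submatrix_one_equiv e)
  · simp only [hprod, conjTranspose_submatrix, submatrix_mul_equiv, blockDiagonal'_conjTranspose,
      ← blockDiagonal'_mul]
    rw [PencilScaling.sum_blockDiagonal'_submatrix, funext hright]
    exact (congrArg (submatrix · e e) blockDiagonal'_one).trans (submatrix_one_equiv e)
end

section
/- Let B_1,…,B_r ∈ M_n(ℂ) satisfy ∑_{i=1}^r B_i B_iᴴ = I and ∑_{i=1}^r B_iᴴ B_i = I. Suppose R, L ⊆ ℂ^n are subspaces with dim R = dim L = k for some 1 ≤ k ≤ n−1 and B_i(R) ⊆ L for all i. Then B_i(R^⊥) ⊆ L^⊥ for all i, where ⊥ denotes the orthogonal complement with respect to the standard Hermitian inner product on ℂ^n. -/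
open Matrix
open scoped ComplexOrder

/-- The squared norm of the orthogonal projection onto `U`, in an orthonormal basis of `U`. -/
lemma sum_sq_norm_inner_eq_sq_norm_orthogonalProjectionOnto {𝕜 E κ : Type*} [RCLike 𝕜]
    [NormedAddCommGroup E] [InnerProductSpace 𝕜 E] [Fintype κ] (U : Submodule 𝕜 E)
    [U.HasOrthogonalProjection] (b : OrthonormalBasis κ 𝕜 U) (v : E) :
    ∑ j, ‖inner 𝕜 (b j : E) v‖ ^ 2 = ‖U.orthogonalProjectionOnto v‖ ^ 2 := by
  rw [← b.sum_sq_norm_inner_right]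
  refine Finset.sum_congr rfl fun j _ => ?_
  rw [Submodule.inner_orthogonalProjectionOnto_eq_of_mem_left]

/-- If the families `T i` and `(T i)†` are both jointly isometric and every `T i` maps `R` into
`L`, with `dim R = dim L`, then every `(T i)†` maps `L` into `R`. -/
lemma adjoint_mem_of_forall_sum_sq_norm_eq {𝕜 E ι : Type*} [RCLike 𝕜] [NormedAddCommGroup E]
    [InnerProductSpace 𝕜 E] [FiniteDimensional 𝕜 E] [Fintype ι] (T : ι → E →ₗ[𝕜] E)
    (hT : ∀ x, ∑ i, ‖T i x‖ ^ 2 = ‖x‖ ^ 2)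
    (hT' : ∀ x, ∑ i, ‖(T i).adjoint x‖ ^ 2 = ‖x‖ ^ 2)
    {R L : Submodule 𝕜 E} (hdim : Module.finrank 𝕜 R = Module.finrank 𝕜 L)
    (hmap : ∀ i, ∀ x ∈ R, T i x ∈ L) (i : ι) {y : E} (hy : y ∈ L) :
    (T i).adjoint y ∈ R := by
  let e := stdOrthonormalBasis 𝕜 R
  let f := stdOrthonormalBasis 𝕜 L
  have he (j) : ‖(e j : E)‖ = 1 := e.orthonormal.1 j
  have hf (m) : ‖(f m : E)‖ = 1 := f.orthonormal.1 m
  have key : ∑ m, ∑ i, ‖R.orthogonalProjectionOnto ((T i).adjoint (f m))‖ ^ 2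
      = (Module.finrank 𝕜 L : ℝ) := by
    calc ∑ m, ∑ i, ‖R.orthogonalProjectionOnto ((T i).adjoint (f m))‖ ^ 2
        = ∑ m, ∑ i, ∑ j, ‖inner 𝕜 (f m : E) (T i (e j))‖ ^ 2 := by
          refine Finset.sum_congr rfl fun m _ => Finset.sum_congr rfl fun i _ => ?_
          rw [← sum_sq_norm_inner_eq_sq_norm_orthogonalProjectionOnto R e]
          refine Finset.sum_congr rfl fun j _ => ?_
          rw [LinearMap.adjoint_inner_right, norm_inner_symm]
      _ = ∑ j, ∑ i, ∑ m, ‖inner 𝕜 (f m : E) (T i (e j))‖ ^ 2 := by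
          rw [Finset.sum_comm, Finset.sum_comm (s := (Finset.univ : Finset (Fin _)))]
          exact Finset.sum_congr rfl fun i _ => Finset.sum_comm
      _ = ∑ j, ∑ i, ‖T i (e j)‖ ^ 2 := by
          refine Finset.sum_congr rfl fun j _ => Finset.sum_congr rfl fun i _ => ?_
          rw [sum_sq_norm_inner_eq_sq_norm_orthogonalProjectionOnto L f, Submodule.coe_norm,
            ← Submodule.starProjection_apply,
            Submodule.starProjection_eq_self_iff.2 (hmap i _ (e j).2)]
      _ = (Module.finrank 𝕜 L : ℝ) := by simp [hT, he, hdim]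
  have total : ∑ m, ∑ i, ‖(T i).adjoint (f m : E)‖ ^ 2 = (Module.finrank 𝕜 L : ℝ) := by
    simp [hT', hf]
  have zero : ∑ m, ∑ i, ‖Rᗮ.orthogonalProjectionOnto ((T i).adjoint (f m))‖ ^ 2 = 0 := by
    simp_rw [fun v : E => R.norm_sq_eq_add_norm_sq_projection v, Finset.sum_add_distrib] at total
    linarith
  have basis_mem (m) : (T i).adjoint (f m) ∈ R := by
    rw [Finset.sum_eq_zero_iff_of_nonneg fun _ _ => by positivity] at zero
    have h := zero m (Finset.mem_univ m)
    rw [Finset.sum_eq_zero_iff_of_nonneg fun _ _ => by positivity] at h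
    have h := h i (Finset.mem_univ i)
    rw [sq_eq_zero_iff, norm_eq_zero, Submodule.orthogonalProjectionOnto_eq_zero_iff,
      Submodule.orthogonal_orthogonal] at h
    exact h
  have hsum : y = ∑ m, inner 𝕜 (f m) ⟨y, hy⟩ • (f m : E) := by
    simpa using (congrArg Subtype.val (f.sum_repr' ⟨y, hy⟩)).symm
  rw [hsum, map_sum]
  refine Submodule.sum_mem _ fun m _ => ?_
  rw [map_smul]
  exact R.smul_mem _ (basis_mem m)

/-- If `∑ᵢ Aᵢᴴ Aᵢ = 1`, then the family `A` is jointly isometric. -/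
lemma sum_sq_norm_toEuclideanLin {𝕜 ι n : Type*} [RCLike 𝕜] [Fintype ι] [Fintype n]
    [DecidableEq n] (A : ι → Matrix n n 𝕜) (h : ∑ i, (A i)ᴴ * A i = 1)
    (x : EuclideanSpace 𝕜 n) : ∑ i, ‖Matrix.toEuclideanLin (A i) x‖ ^ 2 = ‖x‖ ^ 2 := by
  have hx : ∑ i, Matrix.toEuclideanLin (A i)ᴴ (Matrix.toEuclideanLin (A i) x) = x := by
    have h' := congrArg (fun M => Matrix.toEuclideanLin M x) h
    simpa [Matrix.toLpLin_mul_same, Matrix.toLpLin_one] using h'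
  have hinner : ∑ i, inner 𝕜 (Matrix.toEuclideanLin (A i) x) (Matrix.toEuclideanLin (A i) x)
      = inner 𝕜 x x := by
    conv_rhs => arg 2; rw [← hx]
    rw [sum_inner]
    refine Finset.sum_congr rfl fun i _ => ?_
    rw [Matrix.toEuclideanLin_conjTranspose_eq_adjoint, LinearMap.adjoint_inner_left]
  simp_rw [inner_self_eq_norm_sq_to_K] at hinner
  exact_mod_cast hinner

/-- **splitting lemma for doubly stochastic maps.** If `∑ᵢ Bᵢ Bᵢᴴ = I` and
`∑ᵢ Bᵢᴴ Bᵢ = I`, and `(R, L)` is a splitting pair (`dim R = dim L = k`, `1 ≤ k ≤ n - 1`,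
`Bᵢ(R) ⊆ L` for all `i`), then also `Bᵢ(R^⊥) ⊆ L^⊥` for all `i`. -/
theorem splitting_lemma_doubly_stochastic {n r : ℕ}
    (B : Fin r → Matrix (Fin n) (Fin n) ℂ)
    (h1 : ∑ i, B i * (B i)ᴴ = 1) (h2 : ∑ i, (B i)ᴴ * B i = 1)
    (R L : Submodule ℂ (EuclideanSpace ℂ (Fin n))) (k : ℕ)
    (hk1 : 1 ≤ k) (hk2 : k ≤ n - 1)
    (hR : Module.finrank ℂ R = k) (hL : Module.finrank ℂ L = k)
    (hmap : ∀ i, Submodule.map (Matrix.toEuclideanLin (B i)) R ≤ L) :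
    ∀ i, Submodule.map (Matrix.toEuclideanLin (B i)) Rᗮ ≤ Lᗮ := by
  rintro i _ ⟨x, hx, rfl⟩
  have hadj (i) : (Matrix.toEuclideanLin (B i)).adjoint = Matrix.toEuclideanLin (B i)ᴴ :=
    (Matrix.toEuclideanLin_conjTranspose_eq_adjoint _).symm
  rw [Submodule.mem_orthogonal]
  intro y hy
  rw [← LinearMap.adjoint_inner_left]
  refine Submodule.inner_right_of_mem_orthogonal ?_ hx
  refine adjoint_mem_of_forall_sum_sq_norm_eq (fun i => Matrix.toEuclideanLin (B i))
    (sum_sq_norm_toEuclideanLin B h2) ?_ (hR.trans hL.symm)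
    (fun i x hx => hmap i (Submodule.mem_map_of_mem hx)) i hy
  simp_rw [hadj]
  exact sum_sq_norm_toEuclideanLin (fun i => (B i)ᴴ) (by simpa using h1)
end

section
/- Let P_1,…,P_m ∈ M_n(ℂ) be pairwise orthogonal Hermitian projections with ∑_j P_j = I, and let η(X) = ∑_i A_i X A_iᴴ be a completely positive map on M_n(ℂ) which is bimodular over the projections, i.e., η(P_j X P_k) = P_j η(X) P_k for all j, k and all X. Suppose that for each j there exist matrices a_j, b_j with a_j = P_j a_j P_j and b_j = P_j b_j P_j, each invertible in the corner algebra P_j M_n(ℂ) P_j (i.e., there exist a_j', b_j' in the corner with a_j a_j' = a_j' a_j = P_j and b_j b_j' = b_j' b_j = P_j), such that a_j η(b_jᴴ b_j) a_jᴴ = P_j and b_j η*(a_jᴴ a_j) b_jᴴ = P_j, where η*(X) = ∑_i A_iᴴ X A_i. Then d_1 := ∑_j a_j and d_2 := ∑_j b_j are invertible in M_n(ℂ), and the scaled map η'(X) = d_1 η(d_2ᴴ X d_2) d_1ᴴ satisfies η'(I) = I and η'*(I) = I, where η'*(Y) = d_2 η*(d_1ᴴ Y d_1) d_2ᴴ;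 that is, η' is doubly stochastic. -/
open Matrix
open scoped ComplexOrder

/-- The map `Y ↦ ∑ᵢ Aᵢᴴ Y Aᵢ`, adjoint to `X ↦ ∑ᵢ Aᵢ X Aᵢᴴ` for the trace pairing. -/
theorem trace_sum_conjTranspose_mul_mul {ι κ : Type*} [Fintype ι] [Fintype κ]
    (A : κ → Matrix ι ι ℂ) (X Y : Matrix ι ι ℂ) :
    ((∑ i, (A i)ᴴ * Y * A i) * X).trace = (Y * ∑ i, A i * X * (A i)ᴴ).trace := by
  simp only [Finset.sum_mul, Finset.mul_sum, trace_sum]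
  refine Finset.sum_congr rfl fun i _ => ?_
  rw [Matrix.mul_assoc, Matrix.mul_assoc, trace_mul_comm]
  simp only [Matrix.mul_assoc]

/-- Bimodularity over a family of matrices passes from a completely positive map to its adjoint. -/
theorem bimodular_adjoint {ι κ μ : Type*} [Fintype ι] [DecidableEq ι] [Fintype κ]
    (A : κ → Matrix ι ι ℂ) (P : μ → Matrix ι ι ℂ)
    (hbimod : ∀ (j k : μ) (X : Matrix ι ι ℂ),
      ∑ i, A i * (P j * X * P k) * (A i)ᴴ = P j * (∑ i, A i * X * (A i)ᴴ) * P k)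
    (j k : μ) (Y : Matrix ι ι ℂ) :
    ∑ i, (A i)ᴴ * (P j * Y * P k) * A i = P j * (∑ i, (A i)ᴴ * Y * A i) * P k := by
  refine Matrix.ext_iff_trace_mul_right.mpr fun X => ?_
  calc ((∑ i, (A i)ᴴ * (P j * Y * P k) * A i) * X).trace
      = (P j * (Y * P k * ∑ i, A i * X * (A i)ᴴ)).trace := by
        rw [trace_sum_conjTranspose_mul_mul]
        simp only [Matrix.mul_assoc]
    _ = (Y * ∑ i, A i * (P k * X * P j) * (A i)ᴴ).trace := by
        rw [trace_mul_comm, hbimod]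
        simp only [Matrix.mul_assoc]
    _ = ((∑ i, (A i)ᴴ * Y * A i) * P k * X * P j).trace := by
        rw [← trace_sum_conjTranspose_mul_mul]
        simp only [Matrix.mul_assoc]
    _ = (P j * (∑ i, (A i)ᴴ * Y * A i) * P k * X).trace := by
        rw [trace_mul_comm]
        simp only [Matrix.mul_assoc]

/-- If the corner scalings `a j`, `b j` make each corner of a bimodular map unital, then the
block-diagonal scalings `∑ j, a j`, `∑ j, b j` make the whole map unital. -/
theorem scaled_map_one_of_blockwise {ι κ μ : Type*} [Fintype ι] [DecidableEq ι] [Fintype κ]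
    [Fintype μ] (A : κ → Matrix ι ι ℂ) (P : μ → Matrix ι ι ℂ)
    (hherm : ∀ j, (P j).IsHermitian) (hproj : ∀ j, P j * P j = P j)
    (horth : ∀ j k, j ≠ k → P j * P k = 0) (hsum : ∑ j, P j = 1)
    (hbimod : ∀ (j k : μ) (X : Matrix ι ι ℂ),
      ∑ i, A i * (P j * X * P k) * (A i)ᴴ = P j * (∑ i, A i * X * (A i)ᴴ) * P k)
    (a b : μ → Matrix ι ι ℂ)
    (ha : ∀ j, a j = P j * a j * P j) (hb : ∀ j, b j = P j * b j * P j)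
    (hrow : ∀ j, a j * (∑ i, A i * ((b j)ᴴ * b j) * (A i)ᴴ) * (a j)ᴴ = P j) :
    (∑ j, a j) * (∑ i, A i * ((∑ j, b j)ᴴ * (∑ j, b j)) * (A i)ᴴ) * (∑ j, a j)ᴴ = 1 := by
  classical
  have hPb : ∀ j, P j * b j = b j := fun j => by
    rw [hb j, ← Matrix.mul_assoc, ← Matrix.mul_assoc, hproj]
  have hbP : ∀ j, b j * P j = b j := fun j => by
    rw [hb j, Matrix.mul_assoc, hproj]
  have haP : ∀ j, a j * P j = a j := fun j => by
    rw [ha j, Matrix.mul_assoc, hproj]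
  have hbstar : ∀ j, P j * (b j)ᴴ = (b j)ᴴ := fun j => by
    rw [← (hherm j).eq, ← conjTranspose_mul, hbP]
  have hsumaP : ∀ j, (∑ k, a k) * P j = a j := fun j => by
    rw [Finset.sum_mul, Finset.sum_eq_single j (fun k _ hk => ?_) (by simp), haP]
    rw [← haP k, Matrix.mul_assoc, horth k j hk, Matrix.mul_zero]
  have hPsuma : ∀ j, P j * (∑ k, a k)ᴴ = (a j)ᴴ := fun j => by
    rw [← hsumaP j, conjTranspose_mul, (hherm j).eq]
  have hcross : ∀ j k, j ≠ k → (b j)ᴴ * b k = 0 := fun j k hjk => by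
    rw [← hPb j, ← hPb k, conjTranspose_mul, (hherm j).eq, Matrix.mul_assoc,
      ← Matrix.mul_assoc (P j), horth j k hjk, Matrix.zero_mul, Matrix.mul_zero]
  have hgram : (∑ j, b j)ᴴ * (∑ j, b j) = ∑ j, (b j)ᴴ * b j := by
    rw [conjTranspose_sum, Finset.sum_mul]
    refine Finset.sum_congr rfl fun j _ => ?_
    rw [Finset.mul_sum]
    exact Finset.sum_eq_single j (fun k _ hk => hcross j k hk.symm) (by simp)
  have hcorner : ∀ j, ∑ i, A i * ((b j)ᴴ * b j) * (A i)ᴴ =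
      P j * (∑ i, A i * ((b j)ᴴ * b j) * (A i)ᴴ) * P j := fun j => by
    rw [← hbimod, ← Matrix.mul_assoc (P j), hbstar, Matrix.mul_assoc, hbP]
  have hmap : ∑ i, A i * ((∑ j, b j)ᴴ * (∑ j, b j)) * (A i)ᴴ =
      ∑ j, ∑ i, A i * ((b j)ᴴ * b j) * (A i)ᴴ := by
    rw [hgram, Finset.sum_comm]
    simp only [Finset.mul_sum, Finset.sum_mul]
  rw [hmap, Finset.mul_sum, Finset.sum_mul, ← hsum]
  refine Finset.sum_congr rfl fun j _ => ?_
  rw [hcorner, ← Matrix.mul_assoc, ← Matrix.mul_assoc, hsumaP, Matrix.mul_assoc, hPsuma, hrow]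

/-- **blockwise DS implies global DS for bimodular maps.** Given pairwise
orthogonal Hermitian projections `P₁, …, P_m` summing to `I`, a completely positive map
`η(X) = ∑ᵢ Aᵢ X Aᵢᴴ` that is bimodular over the projections, and blockwise scalings
`a_j, b_j` (supported and invertible in the corners `P_j M_n P_j`) making each corner doubly
stochastic, the sums `d₁ = ∑ⱼ aⱼ`, `d₂ = ∑ⱼ bⱼ` are invertible and the scaled map
`η'(X) = d₁ η(d₂ᴴ X d₂) d₁ᴴ` is doubly stochastic. -/
theorem blockwise_ds_implies_global_ds {n r m : ℕ}
    (A : Fin r → Matrix (Fin n) (Fin n) ℂ)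
    (P : Fin m → Matrix (Fin n) (Fin n) ℂ)
    (hherm : ∀ j, (P j).IsHermitian)
    (hproj : ∀ j, P j * P j = P j)
    (horth : ∀ j k, j ≠ k → P j * P k = 0)
    (hsum : ∑ j, P j = 1)
    (hbimod : ∀ (j k : Fin m) (X : Matrix (Fin n) (Fin n) ℂ),
      ∑ i, A i * (P j * X * P k) * (A i)ᴴ = P j * (∑ i, A i * X * (A i)ᴴ) * P k)
    (a b : Fin m → Matrix (Fin n) (Fin n) ℂ)
    (ha : ∀ j, a j = P j * a j * P j) (hb : ∀ j, b j = P j * b j * P j)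
    (hainv : ∀ j, ∃ a' : Matrix (Fin n) (Fin n) ℂ,
      a' = P j * a' * P j ∧ a j * a' = P j ∧ a' * a j = P j)
    (hbinv : ∀ j, ∃ b' : Matrix (Fin n) (Fin n) ℂ,
      b' = P j * b' * P j ∧ b j * b' = P j ∧ b' * b j = P j)
    (hrow : ∀ j, a j * (∑ i, A i * ((b j)ᴴ * b j) * (A i)ᴴ) * (a j)ᴴ = P j)
    (hcol : ∀ j, b j * (∑ i, (A i)ᴴ * ((a j)ᴴ * a j) * A i) * (b j)ᴴ = P j) :
    IsUnit (∑ j, a j) ∧ IsUnit (∑ j, b j) ∧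
    (∑ j, a j) * (∑ i, A i * ((∑ j, b j)ᴴ * (∑ j, b j)) * (A i)ᴴ) * (∑ j, a j)ᴴ = 1 ∧
    (∑ j, b j) * (∑ i, (A i)ᴴ * ((∑ j, a j)ᴴ * (∑ j, a j)) * A i) * (∑ j, b j)ᴴ = 1 := by
  have hone := scaled_map_one_of_blockwise A P hherm hproj horth hsum hbimod a b ha hb hrow
  have hadj := scaled_map_one_of_blockwise (fun i => (A i)ᴴ) P hherm hproj horth hsum
    (by simpa only [conjTranspose_conjTranspose] using bimodular_adjoint A P hbimod) b a hb ha
    (by simpa only [conjTranspose_conjTranspose] using hcol)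
  simp only [conjTranspose_conjTranspose] at hadj
  exact ⟨IsUnit.of_mul_eq_one _ (by rwa [Matrix.mul_assoc] at hone),
    IsUnit.of_mul_eq_one _ (by rwa [Matrix.mul_assoc] at hadj), hone, hadj⟩
end

section
/- Let B_1,…,B_r ∈ M_n(ℂ) be Hermitian matrices, let η(X) = ∑_{i=1}^r B_i X B_i, and let P ∈ M_n(ℂ) be positive definite. If η(I) = P⁻¹ and η(P) = I, then η(P^t) = P^{t−1} for all t ∈ [0,1], where P^s denotes the real power of the positive definite matrix P defined by the functional calculus (spectral decomposition) of P. -/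
open Matrix
open scoped ComplexOrder

/-- Real power of a Hermitian (in applications: positive definite) matrix, defined via the
spectral decomposition (functional calculus); junk value `0` for non-Hermitian input. -/
noncomputable def matrixRPow {n : ℕ} (P : Matrix (Fin n) (Fin n) ℂ) (t : ℝ) :
    Matrix (Fin n) (Fin n) ℂ :=
  if hP : P.IsHermitian then
    (hP.eigenvectorUnitary : Matrix (Fin n) (Fin n) ℂ) *
      Matrix.diagonal (fun i => ((hP.eigenvalues i ^ t : ℝ) : ℂ)) *
      (star (hP.eigenvectorUnitary : Matrix (Fin n) (Fin n) ℂ))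
  else 0

/-- If `η(I) = P⁻¹` and `η(P) = I`, then every `Bᵢ` commutes with `P`, since the commutators have
total squared Frobenius norm zero. -/
theorem commute_of_two_cycle {n r : ℕ}
    (B : Fin r → Matrix (Fin n) (Fin n) ℂ) (hB : ∀ i, (B i).IsHermitian)
    (P : Matrix (Fin n) (Fin n) ℂ) (hP : P.PosDef)
    (h1 : ∑ i, B i * B i = P⁻¹)
    (h2 : ∑ i, B i * P * B i = 1) (i : Fin r) : Commute (B i) P := by
  have hu : IsUnit P.det := (Matrix.isUnit_iff_isUnit_det P).1 hP.isUnit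
  have htrace (j : Fin r) :
      ((B j * P - P * B j)ᴴ * (B j * P - P * B j)).trace =
        2 * (P * P * (B j * B j)).trace - 2 * (P * (B j * P * B j)).trace := by
    have e1 : (P * B j * (B j * P)).trace = (P * P * (B j * B j)).trace := by
      rw [Matrix.trace_mul_comm, ← Matrix.trace_mul_comm (B j * B j)]
      rw [show B j * P * (P * B j) = B j * (P * P * B j) by simp only [Matrix.mul_assoc],
        Matrix.trace_mul_comm, Matrix.mul_assoc, Matrix.trace_mul_comm]
    have e2 : (B j * P * (P * B j)).trace = (P * P * (B j * B j)).trace := by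
      rw [Matrix.trace_mul_comm, e1]
    have e3 : (B j * P * (B j * P)).trace = (P * (B j * P * B j)).trace := by
      rw [Matrix.trace_mul_comm P]
      simp only [Matrix.mul_assoc]
    have e4 : (P * B j * (P * B j)).trace = (P * (B j * P * B j)).trace := by
      simp only [Matrix.mul_assoc]
    rw [Matrix.conjTranspose_sub, Matrix.conjTranspose_mul, Matrix.conjTranspose_mul,
      (hB j).eq, hP.isHermitian.eq, Matrix.sub_mul, Matrix.mul_sub, Matrix.mul_sub]
    simp only [Matrix.trace_sub]
    rw [e1, e2, e3, e4]
    ring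
  have hsum : ∑ j, ((B j * P - P * B j)ᴴ * (B j * P - P * B j)).trace = 0 := by
    simp only [htrace]
    rw [Finset.sum_sub_distrib, ← Finset.mul_sum, ← Finset.mul_sum, ← Matrix.trace_sum,
      ← Matrix.trace_sum, ← Finset.mul_sum, ← Finset.mul_sum, h1, h2, Matrix.mul_assoc,
      Matrix.mul_nonsing_inv P hu, sub_self]
  have hi := (Finset.sum_eq_zero_iff_of_nonneg fun j _ =>
    (Matrix.posSemidef_conjTranspose_mul_self (B j * P - P * B j)).trace_nonneg).1 hsum i
      (Finset.mem_univ i)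
  exact sub_eq_zero.1 (Matrix.trace_conjTranspose_mul_self_eq_zero_iff.1 hi)

theorem matrixRPow_eq_cfc {n : ℕ} {P : Matrix (Fin n) (Fin n) ℂ} (hP : P.IsHermitian) (t : ℝ) :
    matrixRPow P t = cfc (fun x : ℝ => x ^ t) P := by
  rw [hP.cfc_eq, matrixRPow, dif_pos hP, Matrix.IsHermitian.cfc, Unitary.conjStarAlgAut_apply]
  rfl

theorem matrixRPow_sub_one_mul_self {n : ℕ} {P : Matrix (Fin n) (Fin n) ℂ} (hP : P.PosDef)
    (t : ℝ) : matrixRPow P (t - 1) * P = matrixRPow P t := by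
  have hs : IsSelfAdjoint P := hP.isHermitian
  have hf : ∀ f : ℝ → ℝ, ContinuousOn f (spectrum ℝ P) := fun f =>
    (Matrix.finite_real_spectrum (A := P)).continuousOn f
  rw [matrixRPow_eq_cfc hP.isHermitian, matrixRPow_eq_cfc hP.isHermitian]
  nth_rewrite 2 [← cfc_id' ℝ P hs]
  rw [← cfc_mul _ _ P (hf _) (hf _)]
  refine cfc_congr fun x hx => ?_
  rw [hP.isHermitian.spectrum_real_eq_range_eigenvalues] at hx
  obtain ⟨i, rfl⟩ := hx
  have := hP.eigenvalues_pos i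
  simp only [Real.rpow_sub_one this.ne']
  field_simp

/-- Let `η(X) = ∑ᵢ Bᵢ X Bᵢ` with Hermitian `Bᵢ`, and let `P` be positive
definite. If `η(I) = P⁻¹` and `η(P) = I`, then `η(P^t) = P^(t-1)` for all `t ∈ [0, 1]`. -/
theorem eta_rpow_of_two_cycle {n r : ℕ}
    (B : Fin r → Matrix (Fin n) (Fin n) ℂ) (hB : ∀ i, (B i).IsHermitian)
    (P : Matrix (Fin n) (Fin n) ℂ) (hP : P.PosDef)
    (h1 : ∑ i, B i * B i = P⁻¹)
    (h2 : ∑ i, B i * P * B i = 1) :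
    ∀ t ∈ Set.Icc (0 : ℝ) 1,
      ∑ i, B i * matrixRPow P t * B i = matrixRPow P (t - 1) := by
  intro t _
  have hu : IsUnit P.det := (Matrix.isUnit_iff_isUnit_det P).1 hP.isUnit
  have hcomm (i : Fin r) : B i * matrixRPow P t = matrixRPow P t * B i := by
    rw [matrixRPow_eq_cfc hP.isHermitian]
    have hc := (commute_of_two_cycle B hB P hP h1 h2 i).symm
    exact (hc.cfc_real (fun x : ℝ => x ^ t)).symm.eq
  simp only [hcomm, Matrix.mul_assoc]
  rw [← Finset.mul_sum, h1, ← matrixRPow_sub_one_mul_self hP, Matrix.mul_assoc,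
    Matrix.mul_nonsing_inv P hu, Matrix.mul_one]
end

section
/- Let A_1,…,A_r ∈ M_n(ℂ) be Hermitian matrices and η(X) = ∑_{i=1}^r A_i X A_i. Let C, D ∈ M_n(ℂ) be positive definite with η(C) = D⁻¹ and η(D) = C⁻¹. Define γ(t) = C^{1/2} (C^{−1/2} D C^{−1/2})^t C^{1/2} for t ∈ [0,1], where matrix powers of positive definite matrices are defined by functional calculus. Then η(γ(t)) = γ(1−t)⁻¹ for all t ∈ [0,1]. In particular, the geometric mean C # D := γ(1/2) = C^{1/2}(C^{−1/2} D C^{−1/2})^{1/2} C^{1/2} satisfies η(C # D) = (C # D)⁻¹. -/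
open Matrix
open scoped ComplexOrder

section MatrixRPow

variable {n : ℕ} {P : Matrix (Fin n) (Fin n) ℂ}

theorem Matrix.IsHermitian.matrixRPow_eq (hP : P.IsHermitian) (t : ℝ) :
    matrixRPow P t = (hP.eigenvectorUnitary : Matrix (Fin n) (Fin n) ℂ) *
      Matrix.diagonal (fun i => ((hP.eigenvalues i ^ t : ℝ) : ℂ)) *
      (star (hP.eigenvectorUnitary : Matrix (Fin n) (Fin n) ℂ)) :=
  dif_pos hP

theorem Matrix.IsHermitian.isHermitian_matrixRPow (hP : P.IsHermitian) (t : ℝ) :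
    (matrixRPow P t).IsHermitian := by
  rw [hP.matrixRPow_eq, star_eq_conjTranspose]
  refine isHermitian_mul_mul_conjTranspose _ (isHermitian_diagonal_of_self_adjoint _ ?_)
  ext i
  simp

theorem Matrix.IsHermitian.matrixRPow_one (hP : P.IsHermitian) : matrixRPow P 1 = P := by
  rw [hP.matrixRPow_eq]
  conv_rhs => rw [hP.spectral_theorem]
  simp [Unitary.conjStarAlgAut_apply, Function.comp_def]

theorem Matrix.IsHermitian.matrixRPow_zero (hP : P.IsHermitian) : matrixRPow P 0 = 1 := by
  simp [hP.matrixRPow_eq]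

theorem Matrix.PosDef.matrixRPow_add (hP : P.PosDef) (s t : ℝ) :
    matrixRPow P (s + t) = matrixRPow P s * matrixRPow P t := by
  simp only [hP.1.matrixRPow_eq]
  have hU := Unitary.coe_star_mul_self hP.1.eigenvectorUnitary
  set U := (hP.1.eigenvectorUnitary : Matrix (Fin n) (Fin n) ℂ)
  simp only [Matrix.mul_assoc]
  rw [← Matrix.mul_assoc (star U) U, hU, Matrix.one_mul,
    ← Matrix.mul_assoc (diagonal _) (diagonal _),
    diagonal_mul_diagonal]
  simp [Real.rpow_add (hP.eigenvalues_pos _)]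

/-- A matrix commuting with `P` commutes with the real powers of `P`. -/
theorem Matrix.IsHermitian.commute_matrixRPow (hP : P.IsHermitian) {B : Matrix (Fin n) (Fin n) ℂ}
    (hB : Commute B P) (t : ℝ) : Commute B (matrixRPow P t) := by
  have h1 := hP.matrixRPow_one
  rw [hP.matrixRPow_eq] at h1 ⊢
  have hU := Unitary.coe_star_mul_self hP.eigenvectorUnitary
  have hU' := mul_eq_one_comm.1 hU
  set U := (hP.eigenvectorUnitary : Matrix (Fin n) (Fin n) ℂ)
  have key (E : Matrix (Fin n) (Fin n) ℂ) :
      Commute B (U * E * star U) ↔ Commute (star U * B * U) E := by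
    simp only [commute_iff_eq]
    constructor
    · intro h
      calc star U * B * U * E = star U * (B * (U * E * star U)) * U := by
            simp only [Matrix.mul_assoc, hU, Matrix.mul_one]
        _ = (star U * U) * E * (star U * B * U) := by
            rw [h]; simp only [Matrix.mul_assoc]
        _ = E * (star U * B * U) := by rw [hU, Matrix.one_mul]
    · intro h
      calc B * (U * E * star U) = U * star U * B * U * E * star U := by
            rw [hU', Matrix.one_mul]; simp only [Matrix.mul_assoc]
        _ = U * (star U * B * U * E) * star U := by simp only [Matrix.mul_assoc]
        _ = U * E * star U * B * (U * star U) := by rw [h]; simp only [Matrix.mul_assoc]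
        _ = U * E * star U * B := by rw [hU', Matrix.mul_one]
  rw [← h1, key] at hB
  rw [key]
  ext j k
  have h := congrFun (congrFun hB j) k
  simp only [Real.rpow_one, mul_diagonal, diagonal_mul] at h ⊢
  by_cases hjk : hP.eigenvalues j = hP.eigenvalues k
  · rw [hjk, mul_comm]
  · have h0 : (star U * B * U) j k = 0 := by
      by_contra h0
      rw [mul_comm] at h
      exact hjk (by exact_mod_cast (mul_right_cancel₀ h0 h).symm)
    simp [h0]

end MatrixRPow

/-- If `∑ Bᵢ²` is the inverse of `M` and `∑ Bᵢ M Bᵢ = 1`, then every `Bᵢ` commutes with `M`: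
the sum of the squared Frobenius norms of the commutators vanishes. -/
theorem commute_of_sum_mul_self {ι m : Type*} [Fintype ι] [Fintype m] [DecidableEq m]
    {B : ι → Matrix m m ℂ} (hB : ∀ i, (B i).IsHermitian) {M : Matrix m m ℂ} (hM : M.IsHermitian)
    (h1 : (∑ i, B i * B i) * M = 1) (h2 : ∑ i, B i * M * B i = 1) (i : ι) :
    Commute (B i) M := by
  have hterm (i : ι) : ((B i * M - M * B i)ᴴ * (B i * M - M * B i)).trace =
      2 * (B i * B i * M * M).trace - 2 * (B i * M * B i * M).trace := by
    rw [conjTranspose_sub, conjTranspose_mul, conjTranspose_mul, (hB i).eq, hM.eq]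
    have e1 : (M * B i * (B i * M)).trace = (B i * B i * M * M).trace := by
      rw [Matrix.mul_assoc M, trace_mul_comm]; simp only [Matrix.mul_assoc]
    have e2 : (M * B i * (M * B i)).trace = (B i * M * B i * M).trace := by
      rw [Matrix.mul_assoc M, trace_mul_comm]; simp only [Matrix.mul_assoc]
    have e3 : (B i * M * (M * B i)).trace = (B i * B i * M * M).trace := by
      rw [← Matrix.mul_assoc, trace_mul_comm]; simp only [Matrix.mul_assoc]
    have e4 : (B i * M * (B i * M)).trace = (B i * M * B i * M).trace := by
      simp only [Matrix.mul_assoc]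
    simp only [Matrix.sub_mul, Matrix.mul_sub, trace_sub, e1, e2, e3, e4]
    ring
  have hsum : ∑ i, ((B i * M - M * B i)ᴴ * (B i * M - M * B i)).trace = 0 := by
    simp only [hterm, Finset.sum_sub_distrib, ← Finset.mul_sum, ← trace_sum, ← Finset.sum_mul]
    simp [h1, h2]
  have hzero := (Finset.sum_eq_zero_iff_of_nonneg fun i _ =>
    (posSemidef_conjTranspose_mul_self (B i * M - M * B i)).trace_nonneg).1 hsum i
      (Finset.mem_univ i)
  exact sub_eq_zero.1 (trace_conjTranspose_mul_self_eq_zero_iff.1 hzero)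

/-- The reflection identity `η(γ(t)) = γ(1 - t)⁻¹`, valid along the whole geodesic. -/
theorem sum_geodesic_eq_inv {ι : Type*} [Fintype ι] {n : ℕ}
    {A : ι → Matrix (Fin n) (Fin n) ℂ} (hA : ∀ i, (A i).IsHermitian)
    {C D : Matrix (Fin n) (Fin n) ℂ} (hC : C.PosDef) (hD : D.PosDef)
    (hCD : ∑ i, A i * C * A i = D⁻¹) (hDC : ∑ i, A i * D * A i = C⁻¹) (t : ℝ) :
    ∑ i, A i * (matrixRPow C (1/2) *
        matrixRPow (matrixRPow C (-(1/2)) * D * matrixRPow C (-(1/2))) t *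
        matrixRPow C (1/2)) * A i
      = (matrixRPow C (1/2) *
          matrixRPow (matrixRPow C (-(1/2)) * D * matrixRPow C (-(1/2))) (1 - t) *
          matrixRPow C (1/2))⁻¹ := by
  have hRR : matrixRPow C (1/2) * matrixRPow C (1/2) = C := by
    rw [← hC.matrixRPow_add, add_halves, hC.1.matrixRPow_one]
  have hRS : matrixRPow C (1/2) * matrixRPow C (-(1/2)) = 1 := by
    rw [← hC.matrixRPow_add, add_neg_cancel, hC.1.matrixRPow_zero]
  have hR : (matrixRPow C (1/2)).IsHermitian := hC.1.isHermitian_matrixRPow _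
  have hS : (matrixRPow C (-(1/2))).IsHermitian := hC.1.isHermitian_matrixRPow _
  generalize matrixRPow C (1/2) = R at *
  generalize matrixRPow C (-(1/2)) = S at *
  have hSR : S * R = 1 := mul_eq_one_comm.1 hRS
  have hM : (S * D * S).PosDef := by
    have h := hD.conjTranspose_mul_mul_same (B := S)
      (mulVec_injective_iff_isUnit.2 (IsUnit.of_mul_eq_one R hSR))
    rwa [hS.eq] at h
  have hRMR : R * (S * D * S) * R = D := by
    calc R * (S * D * S) * R = (R * S) * D * (S * R) := by simp only [Matrix.mul_assoc]
      _ = D := by rw [hRS, hSR, Matrix.one_mul, Matrix.mul_one]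
  generalize S * D * S = M at *
  have hCdet : IsUnit C.det := (isUnit_iff_isUnit_det C).1 hC.isUnit
  have hDdet : IsUnit D.det := (isUnit_iff_isUnit_det D).1 hD.isUnit
  have hB (i : ι) : (R * A i * R).IsHermitian := by
    have h := isHermitian_conjTranspose_mul_mul R (hA i)
    rwa [hR.eq] at h
  have h1 : (∑ i, R * A i * R * (R * A i * R)) * M = 1 := by
    have e : ∑ i, R * A i * R * (R * A i * R) = R * D⁻¹ * R := by
      simp only [← hCD, ← hRR, Finset.mul_sum, Finset.sum_mul, Matrix.mul_assoc]
    rw [e]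
    calc R * D⁻¹ * R * M = R * D⁻¹ * (R * M * R) * S := by
          simp only [Matrix.mul_assoc, hRS, Matrix.mul_one]
      _ = 1 := by rw [hRMR, Matrix.mul_assoc R, nonsing_inv_mul _ hDdet, Matrix.mul_one, hRS]
  have h2 : ∑ i, R * A i * R * M * (R * A i * R) = 1 := by
    have e : ∑ i, R * A i * R * M * (R * A i * R) = R * C⁻¹ * R := by
      simp only [← hDC, ← hRMR, Finset.mul_sum, Finset.sum_mul, Matrix.mul_assoc]
    rw [e]
    refine mul_eq_one_comm.1 ?_
    calc R * (R * C⁻¹) = (R * R) * C⁻¹ := by simp only [Matrix.mul_assoc]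
      _ = 1 := by rw [hRR, mul_nonsing_inv _ hCdet]
  have hcomm (i : ι) : R * A i * R * matrixRPow M t = matrixRPow M t * (R * A i * R) :=
    hM.1.commute_matrixRPow (commute_of_sum_mul_self hB hM.1 h1 h2 i) t
  have hMt : matrixRPow M t * matrixRPow M (1 - t) = M := by
    rw [← hM.matrixRPow_add, add_sub_cancel, hM.1.matrixRPow_one]
  refine (inv_eq_left_inv ?_).symm
  have hterm (i : ι) : A i * (R * matrixRPow M t * R) * A i * (R * matrixRPow M (1 - t) * R) =
      S * (R * A i * R * (R * A i * R) * M) * R := by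
    calc A i * (R * matrixRPow M t * R) * A i * (R * matrixRPow M (1 - t) * R)
        = S * R * A i * R * (matrixRPow M t * (R * A i * R)) * matrixRPow M (1 - t) * R := by
          rw [hSR, Matrix.one_mul]; simp only [Matrix.mul_assoc]
      _ = S * (R * A i * R * (R * A i * R) * (matrixRPow M t * matrixRPow M (1 - t))) * R := by
          rw [← hcomm]; simp only [Matrix.mul_assoc]
      _ = _ := by rw [hMt]
  rw [Finset.sum_mul]
  simp only [hterm]
  rw [← Finset.sum_mul, ← Finset.mul_sum, ← Finset.sum_mul, h1, Matrix.mul_one, hSR]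

/-- **geodesic reflection for 2-cycles.** Let `η(X) = ∑ᵢ Aᵢ X Aᵢ` with
Hermitian `Aᵢ`, and let `C, D` be positive definite with `η(C) = D⁻¹`, `η(D) = C⁻¹`.  With
`γ(t) = C^{1/2} (C^{-1/2} D C^{-1/2})^t C^{1/2}` one has `η(γ(t)) = γ(1 - t)⁻¹` for all
`t ∈ [0, 1]`; in particular the geometric mean `C # D = γ(1/2)` satisfies
`η(C # D) = (C # D)⁻¹`. -/
theorem geodesic_reflection_two_cycle {n r : ℕ}
    (A : Fin r → Matrix (Fin n) (Fin n) ℂ) (hA : ∀ i, (A i).IsHermitian)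
    (C D : Matrix (Fin n) (Fin n) ℂ) (hC : C.PosDef) (hD : D.PosDef)
    (hCD : ∑ i, A i * C * A i = D⁻¹)
    (hDC : ∑ i, A i * D * A i = C⁻¹) :
    (∀ t ∈ Set.Icc (0 : ℝ) 1,
      ∑ i, A i * (matrixRPow C (1/2) *
          matrixRPow (matrixRPow C (-(1/2)) * D * matrixRPow C (-(1/2))) t *
          matrixRPow C (1/2)) * A i
        = (matrixRPow C (1/2) *
            matrixRPow (matrixRPow C (-(1/2)) * D * matrixRPow C (-(1/2))) (1 - t) *
            matrixRPow C (1/2))⁻¹) ∧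
    ∑ i, A i * (matrixRPow C (1/2) *
        matrixRPow (matrixRPow C (-(1/2)) * D * matrixRPow C (-(1/2))) (1/2) *
        matrixRPow C (1/2)) * A i
      = (matrixRPow C (1/2) *
          matrixRPow (matrixRPow C (-(1/2)) * D * matrixRPow C (-(1/2))) (1/2) *
          matrixRPow C (1/2))⁻¹ := by
  refine ⟨fun t _ => sum_geodesic_eq_inv hA hC hD hCD hDC t, ?_⟩
  have h := sum_geodesic_eq_inv hA hC hD hCD hDC (1/2)
  rwa [sub_half] at h
end
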